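/- arXiv:1907.10050 — 2 statements merged into one kernel-verified Lean document; each statement's English description precedes it below -/
import Mathlib

section
/- Let α ∈ (1,2), let μ_α be the rotationally invariant α-stable probability measure on ℝ^d with characteristic function exp(−‖ξ‖^α/2), and let ν_α(du) = c_{α,d}‖u‖^{−d−α}du be its Lévy measure. Define the Poincaré-ratio functional on probability measures μ on ℝ^d by U_α(μ) = sup{ Var(f(X)) / E[∫ |f(X+u) − f(X)|² ν_α(du)] : f Borel, Var(f(X)) < ∞, 0 < E[∫ |f(X+u)−f(X)|² ν_α(du)] < ∞ }, where X ∼ μ. Then U_α(μ_α) = 1. -/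
open MeasureTheory ProbabilityTheory Filter Set
open scoped RealInnerProductSpace ENNReal NNReal Topology

noncomputable section

/-- The normalizing constant `c_{α,d}` of the rotationally invariant `α`-stable law. -/
def stableCst (d : ℕ) (α : ℝ) : ℝ :=
  -α * (α - 1) * Real.Gamma ((α + d) / 2) /
    (4 * Real.cos (α * Real.pi / 2) * Real.Gamma ((α + 1) / 2) *
      Real.pi ^ (((d : ℝ) - 1) / 2) * Real.Gamma (2 - α))

/-- The Lévy measure `ν_α(du) = c_{α,d} ‖u‖^{−d−α} du`. -/
def stableLevy (d : ℕ) (α : ℝ) : Measure (EuclideanSpace ℝ (Fin d)) :=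
  volume.withDensity fun u => ENNReal.ofReal (stableCst d α / ‖u‖ ^ ((d : ℝ) + α))

/-- The characteristic function of a measure on `ℝ^d`. -/
def charFn {d : ℕ} (μ : Measure (EuclideanSpace ℝ (Fin d)))
    (ξ : EuclideanSpace ℝ (Fin d)) : ℂ :=
  ∫ x, Complex.exp (Complex.I * (⟪ξ, x⟫ : ℂ)) ∂μ

/-- The Dirichlet-type energy `E[∫ |f(X+u) − f(X)|² ν_α(du)]`. -/
def Dform {d : ℕ} (να μ : Measure (EuclideanSpace ℝ (Fin d)))
    (f : EuclideanSpace ℝ (Fin d) → ℝ) : ℝ≥0∞ :=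
  ∫⁻ x, (∫⁻ u, ENNReal.ofReal ((f (x + u) - f x) ^ 2) ∂να) ∂μ

/-- The Poincaré-ratio functional `U_α`. -/
def Ufun {d : ℕ} (να μ : Measure (EuclideanSpace ℝ (Fin d))) : ℝ :=
  sSup {v : ℝ | ∃ f : EuclideanSpace ℝ (Fin d) → ℝ, Measurable f ∧
    evariance f μ < ⊤ ∧ 0 < Dform να μ f ∧ Dform να μ f < ⊤ ∧
    v = (evariance f μ).toReal / (Dform να μ f).toReal}

lemma lintegral_rpow_mul_exp_neg_mul {a r : ℝ} (ha : 0 < a) (hr : 0 < r) :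
    ∫⁻ t in Ioi (0 : ℝ), ENNReal.ofReal (t ^ (a - 1) * Real.exp (-(r * t))) =
      ENNReal.ofReal ((1 / r) ^ a * Real.Gamma a) := by
  have h := Real.integral_rpow_mul_exp_neg_mul_Ioi ha hr
  have hpos : 0 < (1 / r) ^ a * Real.Gamma a := by
    have := Real.Gamma_pos_of_pos ha
    positivity
  have h_int : Integrable (fun t : ℝ => t ^ (a - 1) * Real.exp (-(r * t)))
      (volume.restrict (Ioi 0)) := by
    by_contra hn
    rw [integral_undef hn] at h
    exact hpos.ne h
  rw [← h, ofReal_integral_eq_lintegral_ofReal h_int]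
  filter_upwards [ae_restrict_mem measurableSet_Ioi] with t ht
  have ht' : (0 : ℝ) < t := ht
  positivity

lemma lintegral_rpow_Ioo {a b : ℝ} (ha : 0 < a) (hb : 0 ≤ b) :
    ∫⁻ t in Ioo (0 : ℝ) b, ENNReal.ofReal (t ^ (a - 1)) = ENNReal.ofReal (b ^ a / a) := by
  have h_int : IntegrableOn (fun t : ℝ => t ^ (a - 1)) (Ioo 0 b) := by
    have := (intervalIntegral.intervalIntegrable_rpow' (a := 0) (b := b)
      (show -1 < a - 1 by linarith))
    rw [intervalIntegrable_iff_integrableOn_Ioo_of_le hb] at this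
    exact this
  rw [← ofReal_integral_eq_lintegral_ofReal h_int]
  · congr 1
    rw [← integral_Ioc_eq_integral_Ioo, ← intervalIntegral.integral_of_le hb,
      integral_rpow (Or.inl (by linarith))]
    simp [Real.zero_rpow ha.ne']
  · filter_upwards [ae_restrict_mem measurableSet_Ioo] with t ht
    have := ht.1
    positivity

lemma lintegral_exp_neg_Ioo {b : ℝ} (hb : 0 ≤ b) :
    ∫⁻ t in Ioo (0 : ℝ) b, ENNReal.ofReal (Real.exp (-t)) =
      ENNReal.ofReal (1 - Real.exp (-b)) := by
  have h_int : IntegrableOn (fun t : ℝ => Real.exp (-t)) (Ioo 0 b) :=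
    ((by fun_prop : Continuous fun t : ℝ => Real.exp (-t)).integrableOn_Icc).mono_set
      Ioo_subset_Icc_self
  rw [← ofReal_integral_eq_lintegral_ofReal h_int (ae_of_all _ fun t => (Real.exp_pos _).le)]
  congr 1
  rw [← integral_Ioc_eq_integral_Ioo, ← intervalIntegral.integral_of_le hb]
  simp

lemma lintegral_rpow_mul_one_sub_exp {a K : ℝ} (ha : 0 < a) (ha1 : a < 1) (hK : 0 < K) :
    ∫⁻ s in Ioi (0 : ℝ), ENNReal.ofReal (s ^ (a - 1)) * ENNReal.ofReal (1 - Real.exp (-(K / s))) =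
      ENNReal.ofReal (K ^ a / a * Real.Gamma (1 - a)) := by
  have hmeas : MeasurableSet {p : ℝ × ℝ | p.1 * p.2 < K} :=
    measurableSet_lt (by fun_prop) measurable_const
  have h1 : ∀ s ∈ Ioi (0 : ℝ),
      ENNReal.ofReal (s ^ (a - 1)) * ENNReal.ofReal (1 - Real.exp (-(K / s))) =
      ∫⁻ r in Ioi (0 : ℝ), {p : ℝ × ℝ | p.1 * p.2 < K}.indicator
        (fun p => ENNReal.ofReal (p.1 ^ (a - 1)) * ENNReal.ofReal (Real.exp (-p.2))) (s, r) := by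
    intro s hs
    have hs' : (0 : ℝ) < s := hs
    rw [← lintegral_exp_neg_Ioo (by positivity), ← lintegral_const_mul _ (by fun_prop),
      ← lintegral_indicator measurableSet_Ioo, ← lintegral_indicator measurableSet_Ioi]
    refine lintegral_congr fun r => ?_
    simp only [indicator, mem_Ioo, mem_Ioi, mem_ofPred_eq, lt_div_iff₀' hs', ite_and]
  have h2 : ∀ r ∈ Ioi (0 : ℝ),
      ∫⁻ s in Ioi (0 : ℝ), {p : ℝ × ℝ | p.1 * p.2 < K}.indicator
        (fun p => ENNReal.ofReal (p.1 ^ (a - 1)) * ENNReal.ofReal (Real.exp (-p.2))) (s, r) =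
      ENNReal.ofReal (K ^ a / a) *
        ENNReal.ofReal (r ^ ((1 - a) - 1) * Real.exp (-(1 * r))) := by
    intro r hr
    have hr' : (0 : ℝ) < r := hr
    have : ENNReal.ofReal (K ^ a / a) * ENNReal.ofReal (r ^ ((1 - a) - 1) * Real.exp (-(1 * r))) =
        ∫⁻ s in Ioo (0 : ℝ) (K / r), ENNReal.ofReal (s ^ (a - 1)) *
          ENNReal.ofReal (Real.exp (-r)) := by
      rw [lintegral_mul_const _ (by fun_prop), lintegral_rpow_Ioo ha (by positivity),
        ← ENNReal.ofReal_mul (by positivity), ← ENNReal.ofReal_mul (by positivity),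
        Real.div_rpow hK.le hr'.le, show (1 - a) - 1 = -a by ring, Real.rpow_neg hr'.le]
      congr 1
      field_simp
    rw [this, ← lintegral_indicator measurableSet_Ioo, ← lintegral_indicator measurableSet_Ioi]
    refine lintegral_congr fun s => ?_
    simp only [indicator, mem_Ioo, mem_Ioi, mem_ofPred_eq, lt_div_iff₀ hr', ite_and]
  rw [setLIntegral_congr_fun measurableSet_Ioi h1, lintegral_lintegral_swap,
    setLIntegral_congr_fun measurableSet_Ioi h2, lintegral_const_mul _ (by fun_prop),
    lintegral_rpow_mul_exp_neg_mul (by linarith) one_pos, ← ENNReal.ofReal_mul (by positivity)]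
  · simp
  · exact ((by fun_prop : Measurable fun p : ℝ × ℝ => ENNReal.ofReal (p.1 ^ (a - 1)) *
      ENNReal.ofReal (Real.exp (-p.2))).indicator hmeas).aemeasurable

lemma lintegral_one_sub_cos_mul_gaussian {d : ℕ} (ξ : EuclideanSpace ℝ (Fin d)) {s : ℝ}
    (hs : 0 < s) :
    ∫⁻ u, ENNReal.ofReal ((1 - Real.cos ⟪ξ, u⟫) * Real.exp (-(‖u‖ ^ 2 * s))) =
      ENNReal.ofReal ((Real.pi / s) ^ ((d : ℝ) / 2) *
        (1 - Real.exp (-(‖ξ‖ ^ 2 / 4 / s)))) := by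
  have hs' : 0 < (s : ℂ).re := hs
  have hi := GaussianFourier.integrable_cexp_neg_mul_sq_norm_add hs' Complex.I ξ
  have hv := GaussianFourier.integral_cexp_neg_mul_sq_norm_add hs' Complex.I ξ
  have hi0 := GaussianFourier.integrable_cexp_neg_mul_sq_norm_add hs' 0 ξ
  have hv0 := GaussianFourier.integral_cexp_neg_mul_sq_norm_add hs' 0 ξ
  have hre : ∀ u : EuclideanSpace ℝ (Fin d),
      (1 - Real.cos ⟪ξ, u⟫) * Real.exp (-(‖u‖ ^ 2 * s)) =
      (Complex.exp (-(s : ℂ) * ‖u‖ ^ 2 + 0 * ⟪ξ, u⟫)).re -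
      (Complex.exp (-(s : ℂ) * ‖u‖ ^ 2 + Complex.I * ⟪ξ, u⟫)).re := by
    intro u
    rw [Complex.exp_re, Complex.exp_re]
    simp [← Complex.ofReal_pow]
    ring_nf
  simp_rw [hre]
  rw [← ofReal_integral_eq_lintegral_ofReal]
  · have e1 := integral_re hi0
    have e2 := integral_re hi
    have e3 := integral_sub hi0.re hi.re
    simp only [RCLike.re_to_complex] at e1 e2 e3
    rw [e3, e1, e2, hv0, hv]
    have hc : ((Real.pi : ℂ) / s) ^ ((Module.finrank ℝ (EuclideanSpace ℝ (Fin d)) : ℂ) / 2) =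
        (((Real.pi / s) ^ ((d : ℝ) / 2) : ℝ) : ℂ) := by
      rw [Complex.ofReal_cpow (by positivity)]
      simp
    have hx : Complex.exp (Complex.I ^ 2 * (‖ξ‖ : ℂ) ^ 2 / (4 * s)) =
        ((Real.exp (-(‖ξ‖ ^ 2 / 4 / s)) : ℝ) : ℂ) := by
      rw [Complex.ofReal_exp]
      congr 1
      push_cast
      rw [Complex.I_sq]
      field_simp
    have h0 : Complex.exp (0 ^ 2 * (‖ξ‖ : ℂ) ^ 2 / (4 * s)) = 1 := by simp
    rw [hc, hx, h0, ← Complex.ofReal_mul, mul_one, Complex.ofReal_re, Complex.ofReal_re]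
    ring_nf
  · exact hi0.re.sub hi.re
  · refine ae_of_all _ fun u => ?_
    simp only [Pi.zero_apply, ← hre]
    have := Real.cos_le_one ⟪ξ, u⟫
    have := Real.exp_pos (-(‖u‖ ^ 2 * s))
    nlinarith

lemma stableCst_mul_eq (d : ℕ) {α : ℝ} (hα : α ∈ Ioo (1 : ℝ) 2) :
    stableCst d α * (Real.pi ^ ((d : ℝ) / 2) * Real.Gamma (1 - α / 2)) =
      2 ^ α * (α / 4) * Real.Gamma ((α + d) / 2) := by
  obtain ⟨h1, h2⟩ := hα
  have hcos : Real.cos (α * Real.pi / 2) < 0 :=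
    Real.cos_neg_of_pi_div_two_lt_of_lt (by nlinarith [Real.pi_pos]) (by nlinarith [Real.pi_pos])
  have hG1 : 0 < Real.Gamma ((α + 1) / 2) := Real.Gamma_pos_of_pos (by linarith)
  have hG2 : 0 < Real.Gamma (2 - α) := Real.Gamma_pos_of_pos (by linarith)
  have e1 : Real.Gamma (2 - α) = (1 - α) * Real.Gamma (1 - α) := by
    rw [← Real.Gamma_add_one (by linarith)]
    ring_nf
  have e2 : Real.Gamma ((1 - α) / 2) * Real.Gamma (1 - α / 2) =
      Real.Gamma (1 - α) * 2 ^ α * √Real.pi := by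
    have := Real.Gamma_mul_Gamma_add_half ((1 - α) / 2)
    rw [show (1 - α) / 2 + 1 / 2 = 1 - α / 2 by ring, show 2 * ((1 - α) / 2) = 1 - α by ring,
      show 1 - (1 - α) = α by ring] at this
    exact this
  have e3 : Real.Gamma ((α + 1) / 2) * Real.Gamma ((1 - α) / 2) * Real.cos (α * Real.pi / 2) =
      Real.pi := by
    have := Real.Gamma_mul_Gamma_one_sub ((α + 1) / 2)
    rw [show 1 - (α + 1) / 2 = (1 - α) / 2 by ring,
      show Real.pi * ((α + 1) / 2) = α * Real.pi / 2 + Real.pi / 2 by ring,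
      Real.sin_add_pi_div_two] at this
    rw [this, div_mul_cancel₀ _ hcos.ne]
  have e4 : Real.pi ^ ((d : ℝ) / 2) = Real.pi ^ (((d : ℝ) - 1) / 2) * √Real.pi := by
    rw [Real.sqrt_eq_rpow, ← Real.rpow_add Real.pi_pos]
    ring_nf
  have hp : 0 < Real.pi ^ (((d : ℝ) - 1) / 2) := by positivity
  have hsq : √Real.pi * √Real.pi = Real.pi := Real.mul_self_sqrt Real.pi_pos.le
  have hsp : 0 < √Real.pi := Real.sqrt_pos.2 Real.pi_pos
  have hGm : Real.Gamma ((1 - α) / 2) ≠ 0 := by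
    intro h
    rw [h] at e3
    simp at e3
    exact Real.pi_ne_zero e3.symm
  have key : (1 - α) * √Real.pi * Real.Gamma (1 - α / 2) =
      2 ^ α * Real.cos (α * Real.pi / 2) * Real.Gamma ((α + 1) / 2) * Real.Gamma (2 - α) := by
    apply mul_left_cancel₀ hGm
    rw [e1]
    linear_combination (1 - α) * √Real.pi * e2 +
      (1 - α) * Real.Gamma (1 - α) * 2 ^ α * hsq -
      2 ^ α * (1 - α) * Real.Gamma (1 - α) * e3
  unfold stableCst
  rw [div_mul_eq_mul_div, div_eq_iff
    (mul_ne_zero (mul_ne_zero (mul_ne_zero (by linarith) hG1.ne') hp.ne') hG2.ne'), e4]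
  linear_combination α * Real.Gamma ((α + d) / 2) * Real.pi ^ (((d : ℝ) - 1) / 2) * key

lemma stableCst_pos {d : ℕ} {α : ℝ} (hα : α ∈ Ioo (1 : ℝ) 2) : 0 < stableCst d α := by
  have h := stableCst_mul_eq d hα
  obtain ⟨h1, h2⟩ := hα
  have hG : 0 < Real.Gamma ((α + d) / 2) := Real.Gamma_pos_of_pos (by positivity)
  have hG' : 0 < Real.Gamma (1 - α / 2) := Real.Gamma_pos_of_pos (by linarith)
  have : 0 < stableCst d α * (Real.pi ^ ((d : ℝ) / 2) * Real.Gamma (1 - α / 2)) := by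
    rw [h]
    positivity
  exact (mul_pos_iff_of_pos_right (by positivity)).1 this

lemma measurable_stableLevy_density (d : ℕ) (α : ℝ) : Measurable
    fun u : EuclideanSpace ℝ (Fin d) => ENNReal.ofReal (stableCst d α / ‖u‖ ^ ((d : ℝ) + α)) := by
  fun_prop

/-- The Lévy–Khintchine exponent of the rotationally invariant `α`-stable law. -/
lemma lintegral_one_sub_cos_stableLevy {d : ℕ} (hd : 0 < d) {α : ℝ} (hα : α ∈ Ioo (1 : ℝ) 2)
    (ξ : EuclideanSpace ℝ (Fin d)) :
    ∫⁻ u, ENNReal.ofReal (1 - Real.cos ⟪ξ, u⟫) ∂(stableLevy d α) =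
      ENNReal.ofReal (‖ξ‖ ^ α / 2) := by
  have hc := stableCst_pos (d := d) hα
  have hmul := stableCst_mul_eq d hα
  obtain ⟨h1, h2⟩ := hα
  rcases eq_or_ne ξ 0 with rfl | hξ
  · simp [Real.zero_rpow (show α ≠ 0 by linarith)]
  have hξ' : 0 < ‖ξ‖ := norm_pos_iff.2 hξ
  have : Nonempty (Fin d) := ⟨⟨0, hd⟩⟩
  have ha : 0 < ((d : ℝ) + α) / 2 := by positivity
  have hG : 0 < Real.Gamma (((d : ℝ) + α) / 2) := Real.Gamma_pos_of_pos ha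
  set C : ℝ := stableCst d α / Real.Gamma (((d : ℝ) + α) / 2) with hC
  have hCpos : 0 < C := by positivity
  have hdens : ∀ᵐ u : EuclideanSpace ℝ (Fin d),
      ENNReal.ofReal (stableCst d α / ‖u‖ ^ ((d : ℝ) + α)) * ENNReal.ofReal (1 - Real.cos ⟪ξ, u⟫) =
      ENNReal.ofReal C * ∫⁻ s in Ioi (0 : ℝ), ENNReal.ofReal (s ^ (((d : ℝ) + α) / 2 - 1)) *
        ENNReal.ofReal ((1 - Real.cos ⟪ξ, u⟫) * Real.exp (-(‖u‖ ^ 2 * s))) := by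
    filter_upwards [Measure.ae_ne volume (0 : EuclideanSpace ℝ (Fin d))] with u hu
    have hu' : 0 < ‖u‖ := norm_pos_iff.2 hu
    have hcos : 0 ≤ 1 - Real.cos ⟪ξ, u⟫ := by linarith [Real.cos_le_one ⟪ξ, u⟫]
    have : ∀ s ∈ Ioi (0 : ℝ), ENNReal.ofReal (s ^ (((d : ℝ) + α) / 2 - 1)) *
        ENNReal.ofReal ((1 - Real.cos ⟪ξ, u⟫) * Real.exp (-(‖u‖ ^ 2 * s))) =
        ENNReal.ofReal (1 - Real.cos ⟪ξ, u⟫) *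
          ENNReal.ofReal (s ^ (((d : ℝ) + α) / 2 - 1) * Real.exp (-(‖u‖ ^ 2 * s))) := by
      intro s hs
      have hs' : (0 : ℝ) < s := hs
      rw [← ENNReal.ofReal_mul (by positivity), ← ENNReal.ofReal_mul hcos]
      ring_nf
    rw [setLIntegral_congr_fun measurableSet_Ioi this, lintegral_const_mul _ (by fun_prop),
      lintegral_rpow_mul_exp_neg_mul ha (by positivity), ← ENNReal.ofReal_mul (by positivity),
      ← ENNReal.ofReal_mul hcos, ← ENNReal.ofReal_mul (by positivity)]
    congr 1
    have : (1 / ‖u‖ ^ 2) ^ (((d : ℝ) + α) / 2) = 1 / ‖u‖ ^ ((d : ℝ) + α) := by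
      rw [Real.div_rpow zero_le_one (by positivity), Real.one_rpow, ← Real.rpow_natCast,
        ← Real.rpow_mul hu'.le]
      congr 2
      push_cast
      ring
    rw [this, hC]
    field_simp
  rw [stableLevy, lintegral_withDensity_eq_lintegral_mul _ (measurable_stableLevy_density d α)
    (by fun_prop)]
  simp only [Pi.mul_apply]
  rw [lintegral_congr_ae hdens, lintegral_const_mul' _ _ ENNReal.ofReal_ne_top,
    lintegral_lintegral_swap (by fun_prop)]
  have hs : ∀ s ∈ Ioi (0 : ℝ),
      ∫⁻ u : EuclideanSpace ℝ (Fin d), ENNReal.ofReal (s ^ (((d : ℝ) + α) / 2 - 1)) *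
        ENNReal.ofReal ((1 - Real.cos ⟪ξ, u⟫) * Real.exp (-(‖u‖ ^ 2 * s))) =
      ENNReal.ofReal (Real.pi ^ ((d : ℝ) / 2)) * (ENNReal.ofReal (s ^ (α / 2 - 1)) *
        ENNReal.ofReal (1 - Real.exp (-(‖ξ‖ ^ 2 / 4 / s)))) := by
    intro s hs
    have hs' : (0 : ℝ) < s := hs
    rw [lintegral_const_mul _ (by fun_prop), lintegral_one_sub_cos_mul_gaussian ξ hs',
      ← ENNReal.ofReal_mul (by positivity), ← ENNReal.ofReal_mul (by positivity),
      ← ENNReal.ofReal_mul (by positivity)]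
    congr 1
    rw [Real.div_rpow Real.pi_pos.le hs'.le, show ((d : ℝ) + α) / 2 - 1 = (α / 2 - 1) + d / 2 by ring,
      Real.rpow_add hs']
    field_simp
  rw [setLIntegral_congr_fun measurableSet_Ioi hs, lintegral_const_mul _ (by fun_prop),
    lintegral_rpow_mul_one_sub_exp (by linarith) (by linarith) (by positivity),
    ← ENNReal.ofReal_mul (by positivity), ← ENNReal.ofReal_mul hCpos.le]
  congr 1
  have hK : (‖ξ‖ ^ 2 / 4) ^ (α / 2) = ‖ξ‖ ^ α / 2 ^ α := by
    rw [show ‖ξ‖ ^ 2 / 4 = (‖ξ‖ / 2) ^ 2 by ring, ← Real.rpow_natCast, ← Real.rpow_mul (by positivity),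
      ← Real.div_rpow hξ'.le zero_le_two]
    congr 1
    push_cast
    ring
  rw [hK, hC, add_comm (d : ℝ) α] at *
  have h2α : (0 : ℝ) < 2 ^ α := by positivity
  rw [div_mul_eq_mul_div, div_eq_iff hG.ne']
  field_simp at hmul ⊢
  linear_combination hmul

/-- `μ` satisfies a Poincaré inequality on bounded functions with jump measure `ν`,
up to an error `ε` relative to the square of a uniform bound. -/
def HasPoincare {d : ℕ} (μ ν : Measure (EuclideanSpace ℝ (Fin d))) (ε : ℝ) : Prop :=
  ∀ f : EuclideanSpace ℝ (Fin d) → ℝ, Measurable f → ∀ M : ℝ, (∀ x, |f x| ≤ M) →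
    ENNReal.ofReal (variance f μ) ≤ Dform ν μ f + ENNReal.ofReal (ε * M ^ 2)

lemma memLp_of_abs_le {Ω : Type*} [MeasurableSpace Ω] {μ : Measure Ω} [IsFiniteMeasure μ]
    {f : Ω → ℝ} (hf : Measurable f) {M : ℝ} (hM : ∀ x, |f x| ≤ M) (p : ℝ≥0∞) : MemLp f p μ :=
  MemLp.of_bound hf.aestronglyMeasurable M (ae_of_all _ hM)

lemma integrable_of_abs_le {Ω : Type*} [MeasurableSpace Ω] {μ : Measure Ω} [IsFiniteMeasure μ]
    {f : Ω → ℝ} (hf : Measurable f) {M : ℝ} (hM : ∀ x, |f x| ≤ M) : Integrable f μ :=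
  memLp_one_iff_integrable.1 (memLp_of_abs_le hf hM 1)

lemma abs_integral_le_of_abs_le {Ω : Type*} [MeasurableSpace Ω] {μ : Measure Ω}
    [IsProbabilityMeasure μ] {f : Ω → ℝ} {M : ℝ} (hM : ∀ x, |f x| ≤ M) : |∫ x, f x ∂μ| ≤ M := by
  simpa using norm_integral_le_of_norm_le_const (μ := μ) (f := f) (C := M) (ae_of_all _ hM)

lemma measurable_integral_add {d : ℕ} {μ : Measure (EuclideanSpace ℝ (Fin d))} [SFinite μ]
    {f : EuclideanSpace ℝ (Fin d) → ℝ} (hf : Measurable f) :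
    Measurable fun x => ∫ y, f (x + y) ∂μ := by
  have : StronglyMeasurable (fun p : EuclideanSpace ℝ (Fin d) × EuclideanSpace ℝ (Fin d) =>
      f (p.1 + p.2)) := Measurable.stronglyMeasurable (by fun_prop)
  exact (this.integral_prod_right' (ν := μ)).measurable

lemma measurable_lintegral_sq_sub {d : ℕ} {ν : Measure (EuclideanSpace ℝ (Fin d))} [SFinite ν]
    {f : EuclideanSpace ℝ (Fin d) → ℝ} (hf : Measurable f) :
    Measurable fun x => ∫⁻ u, ENNReal.ofReal ((f (x + u) - f x) ^ 2) ∂ν := by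
  have : Measurable (fun p : EuclideanSpace ℝ (Fin d) × EuclideanSpace ℝ (Fin d) =>
      ENNReal.ofReal ((f (p.1 + p.2) - f p.1) ^ 2)) := by fun_prop
  exact this.lintegral_prod_right'

lemma ofReal_sq_integral_le {Ω : Type*} [MeasurableSpace Ω] {μ : Measure Ω}
    [IsProbabilityMeasure μ] {f : Ω → ℝ} (hf : Measurable f) {M : ℝ} (hM : ∀ x, |f x| ≤ M) :
    ENNReal.ofReal ((∫ x, f x ∂μ) ^ 2) ≤ ∫⁻ x, ENNReal.ofReal (f x ^ 2) ∂μ := by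
  have h2 := memLp_of_abs_le (μ := μ) hf hM 2
  rw [← ofReal_integral_eq_lintegral_ofReal h2.integrable_sq (ae_of_all _ fun x => sq_nonneg _)]
  apply ENNReal.ofReal_le_ofReal
  have := variance_eq_sub h2
  have := variance_nonneg f μ
  simp only [Pi.pow_apply] at *
  linarith

/-- The law of total variance for a convolution. -/
lemma ofReal_variance_conv {d : ℕ} {μ₁ μ₂ : Measure (EuclideanSpace ℝ (Fin d))}
    [IsProbabilityMeasure μ₁] [IsProbabilityMeasure μ₂] {f : EuclideanSpace ℝ (Fin d) → ℝ}
    (hf : Measurable f) {M : ℝ} (hM : ∀ x, |f x| ≤ M) :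
    ENNReal.ofReal (variance f (μ₁ ∗ μ₂)) =
      ∫⁻ x, ENNReal.ofReal (variance (fun y => f (x + y)) μ₂) ∂μ₁ +
      ENNReal.ofReal (variance (fun x => ∫ y, f (x + y) ∂μ₂) μ₁) := by
  have hM2 : ∀ x, |f x ^ 2| ≤ M ^ 2 := fun x => by
    rw [abs_pow]
    exact pow_le_pow_left₀ (abs_nonneg _) (hM x) 2
  have hg := measurable_integral_add (μ := μ₂) hf
  have hgM : ∀ x, |∫ y, f (x + y) ∂μ₂| ≤ M := fun x =>
    abs_integral_le_of_abs_le fun y => hM (x + y)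
  have hgM2 : ∀ x, |(∫ y, f (x + y) ∂μ₂) ^ 2| ≤ M ^ 2 := fun x => by
    rw [abs_pow]
    exact pow_le_pow_left₀ (abs_nonneg _) (hgM x) 2
  have hh := measurable_integral_add (μ := μ₂) (hf.pow_const 2)
  have hhM : ∀ x, |∫ y, f (x + y) ^ 2 ∂μ₂| ≤ M ^ 2 := fun x =>
    abs_integral_le_of_abs_le fun y => hM2 (x + y)
  have hv : ∀ x, variance (fun y => f (x + y)) μ₂ =
      ∫ y, f (x + y) ^ 2 ∂μ₂ - (∫ y, f (x + y) ∂μ₂) ^ 2 := fun x => by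
    rw [variance_eq_sub (memLp_of_abs_le (by fun_prop) (fun y => hM (x + y)) 2)]
    simp
  have hv0 : ∀ x, 0 ≤ ∫ y, f (x + y) ^ 2 ∂μ₂ - (∫ y, f (x + y) ∂μ₂) ^ 2 := fun x => by
    rw [← hv]
    exact variance_nonneg _ _
  simp_rw [hv]
  have i1 := integrable_of_abs_le (μ := μ₁) hh hhM
  have i2 := integrable_of_abs_le (μ := μ₁) (hg.pow_const 2) hgM2
  rw [← ofReal_integral_eq_lintegral_ofReal (f := fun x => ∫ y, f (x + y) ^ 2 ∂μ₂ -
    (∫ y, f (x + y) ∂μ₂) ^ 2) (i1.sub i2) (ae_of_all _ hv0),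
    ← ENNReal.ofReal_add (integral_nonneg hv0) (variance_nonneg _ _), integral_sub i1 i2,
    variance_eq_sub (memLp_of_abs_le hf hM 2), variance_eq_sub (memLp_of_abs_le hg hgM 2)]
  simp only [Pi.pow_apply]
  rw [integral_conv (integrable_of_abs_le hf hM),
    integral_conv (integrable_of_abs_le (hf.pow_const 2) hM2)]
  ring_nf

lemma Dform_conv {d : ℕ} {μ₁ μ₂ ν : Measure (EuclideanSpace ℝ (Fin d))} [SFinite μ₂]
    [SFinite ν] {f : EuclideanSpace ℝ (Fin d) → ℝ} (hf : Measurable f) :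
    Dform ν (μ₁ ∗ μ₂) f = ∫⁻ x, Dform ν μ₂ (fun y => f (x + y)) ∂μ₁ := by
  unfold Dform
  rw [Measure.lintegral_conv (measurable_lintegral_sq_sub hf)]
  simp_rw [add_assoc]

lemma Dform_conv_ge {d : ℕ} {μ₁ μ₂ ν : Measure (EuclideanSpace ℝ (Fin d))}
    [SFinite μ₁] [IsProbabilityMeasure μ₂] [SFinite ν] {f : EuclideanSpace ℝ (Fin d) → ℝ}
    (hf : Measurable f) {M : ℝ} (hM : ∀ x, |f x| ≤ M) :
    Dform ν μ₁ (fun x => ∫ y, f (x + y) ∂μ₂) ≤ Dform ν (μ₁ ∗ μ₂) f := by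
  unfold Dform
  rw [Measure.lintegral_conv (measurable_lintegral_sq_sub hf)]
  refine lintegral_mono fun x => ?_
  rw [lintegral_lintegral_swap (by fun_prop)]
  refine lintegral_mono fun u => ?_
  have e : ∀ y, |f (x + y + u) - f (x + y)| ≤ 2 * M := fun y => by
    have h1 := abs_le.1 (hM (x + y + u))
    have h2 := abs_le.1 (hM (x + y))
    exact abs_le.2 ⟨by linarith, by linarith⟩
  have := ofReal_sq_integral_le (μ := μ₂) (f := fun y => f (x + y + u) - f (x + y))
    (by fun_prop) e
  rw [integral_sub (integrable_of_abs_le (by fun_prop) fun y => hM _)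
    (integrable_of_abs_le (by fun_prop) fun y => hM _)] at this
  simpa only [add_right_comm] using this

/-- Poincaré inequalities tensorize along convolutions. -/
lemma HasPoincare.conv {d : ℕ} {μ₁ μ₂ ν₁ ν₂ : Measure (EuclideanSpace ℝ (Fin d))}
    [IsProbabilityMeasure μ₁] [IsProbabilityMeasure μ₂] [SFinite ν₁] [SFinite ν₂] {ε₁ ε₂ : ℝ}
    (hε₁ : 0 ≤ ε₁) (hε₂ : 0 ≤ ε₂) (h₁ : HasPoincare μ₁ ν₁ ε₁) (h₂ : HasPoincare μ₂ ν₂ ε₂) :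
    HasPoincare (μ₁ ∗ μ₂) (ν₁ + ν₂) (ε₁ + ε₂) := by
  intro f hf M hM
  rw [ofReal_variance_conv hf hM]
  have a1 : ∫⁻ x, ENNReal.ofReal (variance (fun y => f (x + y)) μ₂) ∂μ₁ ≤
      Dform ν₂ (μ₁ ∗ μ₂) f + ENNReal.ofReal (ε₂ * M ^ 2) := by
    rw [Dform_conv hf]
    calc _ ≤ ∫⁻ x, (Dform ν₂ μ₂ (fun y => f (x + y)) + ENNReal.ofReal (ε₂ * M ^ 2)) ∂μ₁ :=
          lintegral_mono fun x => h₂ _ (by fun_prop) M fun y => hM _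
      _ = _ := by
          rw [lintegral_add_right _ measurable_const]
          simp
  have a2 := (h₁ _ (measurable_integral_add (μ := μ₂) hf) M
    (fun x => abs_integral_le_of_abs_le fun y => hM _)).trans
      (add_le_add_left (Dform_conv_ge hf hM) _)
  have a3 : Dform (ν₁ + ν₂) (μ₁ ∗ μ₂) f = Dform ν₁ (μ₁ ∗ μ₂) f + Dform ν₂ (μ₁ ∗ μ₂) f := by
    unfold Dform
    simp_rw [lintegral_add_measure]
    exact lintegral_add_left (measurable_lintegral_sq_sub hf) _
  refine (add_le_add a1 a2).trans_eq ?_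
  rw [a3, add_mul, ENNReal.ofReal_add (by positivity) (by positivity)]
  ring

/-- The convolution powers of a measure. -/
def convPow {d : ℕ} (ν : Measure (EuclideanSpace ℝ (Fin d))) :
    ℕ → Measure (EuclideanSpace ℝ (Fin d))
  | 0 => Measure.dirac 0
  | n + 1 => convPow ν n ∗ ν

instance isFiniteMeasure_convPow {d : ℕ} (ν : Measure (EuclideanSpace ℝ (Fin d)))
    [IsFiniteMeasure ν] (n : ℕ) : IsFiniteMeasure (convPow ν n) := by
  induction n with
  | zero => rw [convPow]; infer_instance
  | succ n ih => rw [convPow]; infer_instance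

instance isProbabilityMeasure_convPow {d : ℕ} (ν : Measure (EuclideanSpace ℝ (Fin d)))
    [IsProbabilityMeasure ν] (n : ℕ) : IsProbabilityMeasure (convPow ν n) := by
  induction n with
  | zero => rw [convPow]; infer_instance
  | succ n ih => rw [convPow]; infer_instance

lemma charFun_convPow {d : ℕ} (ν : Measure (EuclideanSpace ℝ (Fin d)))
    [IsFiniteMeasure ν] (n : ℕ) (t : EuclideanSpace ℝ (Fin d)) :
    charFun (convPow ν n) t = charFun ν t ^ n := by
  induction n with
  | zero => simp [convPow]
  | succ n ih => rw [convPow, charFun_conv, ih, pow_succ]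

lemma convPow_univ {d : ℕ} (ν : Measure (EuclideanSpace ℝ (Fin d)))
    [IsFiniteMeasure ν] (n : ℕ) :
    convPow ν n univ = ENNReal.ofReal (ν.real univ ^ n) := by
  induction n with
  | zero => simp [convPow]
  | succ n ih =>
    rw [convPow, Measure.conv, Measure.map_apply (by fun_prop) MeasurableSet.univ, preimage_univ,
      ← univ_prod_univ, Measure.prod_prod, ih, pow_succ, ENNReal.ofReal_mul (by positivity), ofReal_measureReal]

/-- The compound Poisson law with jump measure `ν`. -/
def compoundPoisson {d : ℕ} (ν : Measure (EuclideanSpace ℝ (Fin d))) :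
    Measure (EuclideanSpace ℝ (Fin d)) :=
  Measure.sum fun n => ENNReal.ofReal (Real.exp (-ν.real univ) / n.factorial) • convPow ν n

lemma lintegral_compoundPoisson {d : ℕ} (ν : Measure (EuclideanSpace ℝ (Fin d)))
    (g : EuclideanSpace ℝ (Fin d) → ℝ≥0∞) :
    ∫⁻ x, g x ∂(compoundPoisson ν) =
      ∑' n : ℕ, ENNReal.ofReal (Real.exp (-ν.real univ) / n.factorial) *
        ∫⁻ x, g x ∂(convPow ν n) := by
  simp [compoundPoisson, lintegral_sum_measure, lintegral_smul_measure]

instance isProbabilityMeasure_compoundPoisson {d : ℕ} (ν : Measure (EuclideanSpace ℝ (Fin d)))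
    [IsFiniteMeasure ν] : IsProbabilityMeasure (compoundPoisson ν) := by
  constructor
  rw [← lintegral_one, lintegral_compoundPoisson]
  simp_rw [lintegral_one, convPow_univ]
  have hs : HasSum (fun n : ℕ => Real.exp (-ν.real univ) / n.factorial * ν.real univ ^ n) 1 := by
    have := (NormedSpace.expSeries_div_hasSum_exp (ν.real univ)).mul_left
      (Real.exp (-ν.real univ))
    rw [← Real.exp_eq_exp_ℝ, ← Real.exp_add, neg_add_cancel, Real.exp_zero] at this
    refine this.congr_fun fun n => ?_
    ring
  simp_rw [← ENNReal.ofReal_mul (div_nonneg (Real.exp_pos _).le (Nat.cast_nonneg _))]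
  rw [← ENNReal.ofReal_tsum_of_nonneg (fun n => by positivity) hs.summable, hs.tsum_eq]
  simp

lemma charFun_compoundPoisson {d : ℕ} (ν : Measure (EuclideanSpace ℝ (Fin d)))
    [IsFiniteMeasure ν] (t : EuclideanSpace ℝ (Fin d)) :
    charFun (compoundPoisson ν) t = Complex.exp (charFun ν t - ν.real univ) := by
  have h_int : Integrable (fun x => Complex.exp (⟪x, t⟫ * Complex.I)) (compoundPoisson ν) :=
    (integrable_const (1 : ℝ)).mono (by fun_prop) (by simp [Complex.norm_exp_ofReal_mul_I])
  have h1 := hasSum_integral_measure h_int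
  have h2 : HasSum (fun n : ℕ => (Real.exp (-ν.real univ) : ℂ) *
      (charFun ν t ^ n / n.factorial)) (Complex.exp (charFun ν t - ν.real univ)) := by
    have := (NormedSpace.expSeries_div_hasSum_exp (charFun ν t)).mul_left
      (Real.exp (-ν.real univ) : ℂ)
    rw [← Complex.exp_eq_exp_ℂ, Complex.ofReal_exp, ← Complex.exp_add] at this
    convert! this using 2
    · simp
    · push_cast
      ring
  rw [charFun_apply]
  refine h1.unique (h2.congr_fun fun n => ?_)
  rw [integral_smul_measure, ← charFun_apply, charFun_convPow,
    ENNReal.toReal_ofReal (by positivity), Complex.real_smul]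
  push_cast
  ring

lemma ofReal_variance_le_lintegral_sq {Ω : Type*} [MeasurableSpace Ω] {μ : Measure Ω}
    [IsProbabilityMeasure μ] {f : Ω → ℝ} (hf : Measurable f) {M : ℝ} (hM : ∀ x, |f x| ≤ M)
    (c : ℝ) : ENNReal.ofReal (variance f μ) ≤ ∫⁻ x, ENNReal.ofReal ((f x - c) ^ 2) ∂μ := by
  have h2 : MemLp (fun x => f x - c) 2 μ := (memLp_of_abs_le hf hM 2).sub (memLp_const c)
  rw [← ofReal_integral_eq_lintegral_ofReal h2.integrable_sq (ae_of_all _ fun x => sq_nonneg _),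
    ← variance_sub_const hf.aestronglyMeasurable c]
  exact ENNReal.ofReal_le_ofReal (variance_le_expectation_sq (by fun_prop))

lemma hasPoincare_compoundPoisson_error {d : ℕ} (ν : Measure (EuclideanSpace ℝ (Fin d)))
    [IsFiniteMeasure ν] :
    HasPoincare (compoundPoisson ν) ν (4 * ν.real univ ^ 2) := by
  intro f hf M hM
  refine (ofReal_variance_le_lintegral_sq hf hM (f 0)).trans ?_
  have hb : ∀ x, (f x - f 0) ^ 2 ≤ 4 * M ^ 2 := fun x => by
    have h1 := abs_le.1 (hM x)
    have h2 := abs_le.1 (hM 0)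
    nlinarith
  rw [lintegral_compoundPoisson, ← Summable.sum_add_tsum_nat_add' (k := 2) ENNReal.summable]
  refine add_le_add ?_ ?_
  · rw [Finset.sum_range_succ, Finset.sum_range_one]
    unfold Dform
    rw [lintegral_compoundPoisson]
    refine le_trans ?_ (ENNReal.le_tsum 0)
    have hc : convPow ν 1 = ν := by simp [convPow]
    rw [hc]
    simp [convPow]
  · have hterm : ∀ n : ℕ, ENNReal.ofReal (Real.exp (-ν.real univ) / (n + 2).factorial) *
        ∫⁻ x, ENNReal.ofReal ((f x - f 0) ^ 2) ∂(convPow ν (n + 2)) ≤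
        ENNReal.ofReal (4 * ν.real univ ^ 2 * M ^ 2) *
          (ENNReal.ofReal (Real.exp (-ν.real univ) / n.factorial) *
            ∫⁻ x, 1 ∂(convPow ν n)) := fun n => by
      have hle : ∫⁻ x, ENNReal.ofReal ((f x - f 0) ^ 2) ∂(convPow ν (n + 2)) ≤
          ENNReal.ofReal (4 * M ^ 2) * convPow ν (n + 2) univ := by
        rw [← lintegral_const]
        exact lintegral_mono fun x => ENNReal.ofReal_le_ofReal (hb x)
      refine (mul_le_mul_right hle _).trans ?_
      rw [lintegral_one, convPow_univ, convPow_univ, ← ENNReal.ofReal_mul (by positivity),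
        ← ENNReal.ofReal_mul (by positivity), ← ENNReal.ofReal_mul (by positivity),
        ← ENNReal.ofReal_mul (by positivity)]
      apply ENNReal.ofReal_le_ofReal
      have hfac : Real.exp (-ν.real univ) / (n + 2).factorial ≤
          Real.exp (-ν.real univ) / n.factorial := by
        gcongr
        omega
      calc _ ≤ Real.exp (-ν.real univ) / n.factorial *
            (4 * M ^ 2 * ν.real univ ^ (n + 2)) := by gcongr
        _ = _ := by ring
    refine (ENNReal.tsum_le_tsum hterm).trans_eq ?_
    rw [ENNReal.tsum_mul_left, ← lintegral_compoundPoisson]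
    simp

lemma hasPoincare_dirac {d : ℕ} (x : EuclideanSpace ℝ (Fin d)) :
    HasPoincare (Measure.dirac x) 0 0 := by
  intro f hf M hM
  simp

lemma HasPoincare.convPow {d : ℕ} {μ ν : Measure (EuclideanSpace ℝ (Fin d))}
    [IsProbabilityMeasure μ] [SFinite ν] {ε : ℝ} (hε : 0 ≤ ε) (h : HasPoincare μ ν ε) (n : ℕ) :
    HasPoincare (convPow μ n) ((n : ℝ≥0) • ν) (n * ε) := by
  induction n with
  | zero => simpa [_root_.convPow] using hasPoincare_dirac 0
  | succ n ih =>
    rw [_root_.convPow]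
    push_cast
    rw [add_smul, one_smul, add_mul, one_mul]
    exact ih.conv (by positivity) hε h

lemma convPow_compoundPoisson {d : ℕ} (ν : Measure (EuclideanSpace ℝ (Fin d)))
    [IsFiniteMeasure ν] {n : ℕ} (hn : n ≠ 0) :
    convPow (compoundPoisson ((n : ℝ≥0)⁻¹ • ν)) n = compoundPoisson ν := by
  apply Measure.ext_of_charFun
  ext t
  rw [charFun_convPow, charFun_compoundPoisson, charFun_compoundPoisson, ← Complex.exp_nat_mul]
  congr 1
  have h : charFun ((n : ℝ≥0)⁻¹ • ν) t = (n : ℂ)⁻¹ * charFun ν t := by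
    rw [charFun_apply, integral_smul_nnreal_measure, ← charFun_apply, NNReal.smul_def,
      Complex.real_smul]
    simp
  rw [h]
  have hn' : (n : ℂ) ≠ 0 := by exact_mod_cast hn
  simp only [measureReal_nnreal_smul_apply]
  push_cast
  field_simp

/-- The Poincaré inequality for compound Poisson laws. -/
lemma hasPoincare_compoundPoisson {d : ℕ} (ν : Measure (EuclideanSpace ℝ (Fin d)))
    [IsFiniteMeasure ν] : HasPoincare (compoundPoisson ν) ν 0 := by
  intro f hf M hM
  have key : ∀ n : ℕ, ENNReal.ofReal (variance f (compoundPoisson ν)) ≤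
      Dform ν (compoundPoisson ν) f +
        ENNReal.ofReal ((4 * ν.real univ ^ 2 * M ^ 2) * (1 / ((n : ℝ) + 1))) := fun n => by
    have h := (hasPoincare_compoundPoisson_error (((n + 1 : ℕ) : ℝ≥0)⁻¹ • ν)).convPow
      (by positivity) (n + 1) f hf M hM
    have hn : ((n + 1 : ℕ) : ℝ≥0) ≠ 0 := by positivity
    rw [convPow_compoundPoisson ν n.succ_ne_zero, smul_smul, mul_inv_cancel₀ hn, one_smul] at h
    refine h.trans_eq ?_
    congr 2
    simp only [measureReal_nnreal_smul_apply]
    push_cast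
    field_simp
  have hlim : Tendsto (fun n : ℕ => Dform ν (compoundPoisson ν) f +
      ENNReal.ofReal ((4 * ν.real univ ^ 2 * M ^ 2) * (1 / ((n : ℝ) + 1)))) atTop
      (𝓝 (Dform ν (compoundPoisson ν) f + ENNReal.ofReal (0 * M ^ 2))) := by
    refine tendsto_const_nhds.add (ENNReal.tendsto_ofReal ?_)
    have := (tendsto_one_div_add_atTop_nhds_zero_nat (𝕜 := ℝ)).const_mul
      (4 * ν.real univ ^ 2 * M ^ 2)
    simpa using this
  exact ge_of_tendsto' hlim key

/-- **Lévy's continuity theorem**: a pointwise limit of characteristic functions which is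
continuous at `0` is a characteristic function. -/
lemma exists_charFun_eq_of_tendsto {d : ℕ} {μ : ℕ → ProbabilityMeasure (EuclideanSpace ℝ (Fin d))}
    {φ : EuclideanSpace ℝ (Fin d) → ℂ} (hφ : ContinuousAt φ 0)
    (h : ∀ t, Tendsto (fun n => charFun (μ n) t) atTop (𝓝 (φ t))) :
    ∃ ρ : ProbabilityMeasure (EuclideanSpace ℝ (Fin d)), ∀ t, charFun ρ t = φ t := by
  have h_tight : IsTightMeasureSet
      {(μ n : Measure (EuclideanSpace ℝ (Fin d))) | n} := isTightMeasureSet_of_tendsto_charFun hφ h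
  have h_compact : IsCompact (closure {μ n | n}) :=
    isCompact_closure_of_isTightMeasureSet (by simpa using h_tight)
  let U : Ultrafilter ℕ := Ultrafilter.of atTop
  have hU : (U : Filter ℕ) ≤ atTop := Ultrafilter.of_le atTop
  obtain ⟨ρ, -, hρ : Tendsto _ _ _⟩ := h_compact.ultrafilter_le_nhds (U.map μ)
    (.trans (by simp) (monotone_principal subset_closure))
  refine ⟨ρ, fun t => tendsto_nhds_unique ?_ ((h t).comp hU)⟩
  rw [ProbabilityMeasure.tendsto_iff_forall_integral_rclike_tendsto ℂ] at hρ
  simp_rw [Function.comp_def, charFun_eq_integral_innerProbChar]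
  exact hρ (BoundedContinuousFunction.innerProbChar t)

lemma charFun_sub_real_univ {d : ℕ} (ν : Measure (EuclideanSpace ℝ (Fin d))) [IsFiniteMeasure ν]
    [ν.IsNegInvariant] (t : EuclideanSpace ℝ (Fin d)) :
    charFun ν t - ν.real univ = -((∫ x, (1 - Real.cos ⟪t, x⟫) ∂ν : ℝ) : ℂ) := by
  have hcos : Integrable (fun x => Real.cos ⟪t, x⟫) ν :=
    integrable_of_abs_le (by fun_prop) (M := 1) fun x => Real.abs_cos_le_one _
  have hsin : Integrable (fun x => Real.sin ⟪t, x⟫) ν :=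
    integrable_of_abs_le (by fun_prop) (M := 1) fun x => Real.abs_sin_le_one _
  have h0 : ∫ x, Real.sin ⟪t, x⟫ ∂ν = 0 := by
    have := integral_neg_eq_self (fun x => Real.sin ⟪t, x⟫) ν
    simp only [inner_neg_right, Real.sin_neg, integral_neg] at this
    linarith
  have h1 : charFun ν t = (∫ x, Real.cos ⟪t, x⟫ ∂ν : ℝ) + (∫ x, Real.sin ⟪t, x⟫ ∂ν : ℝ) *
      Complex.I := by
    rw [charFun_apply, ← integral_complex_ofReal, ← integral_complex_ofReal, ← integral_mul_const,
      ← integral_add hcos.ofReal (hsin.ofReal.mul_const _)]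
    congr with x
    rw [Complex.exp_mul_I, real_inner_comm]
    simp
  rw [h1, h0, integral_sub (integrable_const _) hcos]
  simp

lemma isNegInvariant_restrict {d : ℕ} (ν : Measure (EuclideanSpace ℝ (Fin d)))
    [ν.IsNegInvariant] {A : Set (EuclideanSpace ℝ (Fin d))} (hA : MeasurableSet A)
    (hs : -A = A) : (ν.restrict A).IsNegInvariant := by
  constructor
  have h := Measure.restrict_map (μ := ν) (measurable_neg (G := EuclideanSpace ℝ (Fin d))) hA
  have h2 : ν.map Neg.neg = ν := Measure.map_neg_eq_self ν
  change (ν.restrict A).map Neg.neg = ν.restrict A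
  have h3 : Neg.neg ⁻¹' A = A := hs
  rw [h2, h3] at h
  exact h.symm

lemma exists_symmetric_spanning {d : ℕ} (ν : Measure (EuclideanSpace ℝ (Fin d))) [SigmaFinite ν] :
    ∃ A : ℕ → Set (EuclideanSpace ℝ (Fin d)), Monotone A ∧ (∀ n, MeasurableSet (A n)) ∧
      (∀ n, -A n = A n) ∧ (∀ n, ν (A n) < ∞) ∧ ⋃ n, A n = univ := by
  refine ⟨fun n => spanningSets ν n ∩ -spanningSets ν n, fun m n h => ?_, fun n => ?_, fun n => ?_,
    fun n => ?_, ?_⟩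
  · exact inter_subset_inter (monotone_spanningSets ν h)
      (neg_subset_neg.2 (monotone_spanningSets ν h))
  · exact (measurableSet_spanningSets ν n).inter (measurableSet_spanningSets ν n).neg
  · rw [inter_neg, neg_neg, inter_comm]
  · exact (measure_mono inter_subset_left).trans_lt (measure_spanningSets_lt_top ν n)
  · refine eq_univ_of_forall fun x => ?_
    have hx : ∀ y, ∃ i, y ∈ spanningSets ν i := fun y => by
      rw [← mem_iUnion, iUnion_spanningSets]
      exact mem_univ y
    obtain ⟨i, hi⟩ := hx x
    obtain ⟨j, hj⟩ := hx (-x)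
    exact mem_iUnion.2 ⟨max i j, monotone_spanningSets ν (le_max_left i j) hi,
      monotone_spanningSets ν (le_max_right i j) hj⟩

/-- A law with a symmetric Lévy measure splits into a compound Poisson law carrying the jumps in
an exhausting sequence of sets, and a remainder which tends to the point mass at `0`. -/
lemma exists_conv_compoundPoisson {d : ℕ} {μ ν : Measure (EuclideanSpace ℝ (Fin d))}
    [IsProbabilityMeasure μ] [SigmaFinite ν] [ν.IsNegInvariant]
    {ψ : EuclideanSpace ℝ (Fin d) → ℝ} (hψ : Continuous ψ) (hψ0 : ψ 0 = 0)
    (hψ_nonneg : ∀ ξ, 0 ≤ ψ ξ)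
    (hν : ∀ ξ, ∫⁻ u, ENNReal.ofReal (1 - Real.cos ⟪ξ, u⟫) ∂ν = ENNReal.ofReal (ψ ξ))
    (hμ : ∀ ξ, charFun μ ξ = Complex.exp (-(ψ ξ : ℂ))) :
    ∃ (A : ℕ → Set (EuclideanSpace ℝ (Fin d)))
      (ρ : ℕ → ProbabilityMeasure (EuclideanSpace ℝ (Fin d))),
      (∀ k, IsFiniteMeasure (ν.restrict (A k))) ∧
      (∀ k, μ = (ρ k : Measure _) ∗ compoundPoisson (ν.restrict (A k))) ∧
      Tendsto ρ atTop (𝓝 ⟨Measure.dirac 0, inferInstance⟩) := by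
  obtain ⟨A, hmono, hmeas, hsymm, hfin, hunion⟩ := exists_symmetric_spanning ν
  have hnn : ∀ ξ u : EuclideanSpace ℝ (Fin d), 0 ≤ 1 - Real.cos ⟪ξ, u⟫ := fun ξ u => by
    linarith [Real.cos_le_one ⟪ξ, u⟫]
  have h_int : ∀ ξ, Integrable (fun u => 1 - Real.cos ⟪ξ, u⟫) ν := fun ξ => by
    refine ⟨by fun_prop, ?_⟩
    rw [hasFiniteIntegral_iff_ofReal (ae_of_all _ (hnn ξ)), hν ξ]
    exact ENNReal.ofReal_lt_top
  have hval : ∀ ξ, ∫ u, (1 - Real.cos ⟪ξ, u⟫) ∂ν = ψ ξ := fun ξ => by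
    rw [integral_eq_lintegral_of_nonneg_ae (ae_of_all _ (hnn ξ)) (by fun_prop), hν ξ,
      ENNReal.toReal_ofReal (hψ_nonneg ξ)]
  set Ψ : ℕ → EuclideanSpace ℝ (Fin d) → ℝ := fun k ξ =>
    ∫ u in A k, (1 - Real.cos ⟪ξ, u⟫) ∂ν with hΨ
  have hΨ_lim : ∀ ξ, Tendsto (fun k => Ψ k ξ) atTop (𝓝 (ψ ξ)) := fun ξ => by
    have := tendsto_setIntegral_of_monotone hmeas hmono (h_int ξ).integrableOn
    rwa [hunion, setIntegral_univ, hval] at this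
  have hΨ_nonneg : ∀ k ξ, 0 ≤ Ψ k ξ := fun k ξ => integral_nonneg (hnn ξ)
  have hΨ_le : ∀ k ξ, Ψ k ξ ≤ ψ ξ := fun k ξ => by
    rw [← hval]
    exact setIntegral_le_integral (h_int ξ) (ae_of_all _ (hnn ξ))
  have hf : ∀ k, IsFiniteMeasure (ν.restrict (A k)) := fun k => ⟨by simpa using hfin k⟩
  have hf' : ∀ m k, IsFiniteMeasure (ν.restrict (A m \ A k)) := fun m k =>
    ⟨by simpa using (measure_mono sdiff_subset).trans_lt (hfin m)⟩
  have hcp : ∀ k ξ, charFun (compoundPoisson (ν.restrict (A k))) ξ =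
      Complex.exp (-(Ψ k ξ : ℂ)) := fun k ξ => by
    have := isNegInvariant_restrict ν (hmeas k) (hsymm k)
    rw [charFun_compoundPoisson, charFun_sub_real_univ]
  have hcp' : ∀ k m, k ≤ m → ∀ ξ, charFun (compoundPoisson (ν.restrict (A m \ A k))) ξ =
      Complex.exp (-((Ψ m ξ - Ψ k ξ : ℝ) : ℂ)) := fun k m hkm ξ => by
    have := isNegInvariant_restrict ν ((hmeas m).diff (hmeas k))
      (by rw [sdiff_eq, inter_neg, compl_neg, hsymm, hsymm])
    rw [charFun_compoundPoisson, charFun_sub_real_univ,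
      setIntegral_sdiff (hmeas k) (h_int ξ).integrableOn (hmono hkm)]
  have hres : ∀ k, ∃ ρ : ProbabilityMeasure (EuclideanSpace ℝ (Fin d)),
      ∀ ξ, charFun ρ ξ = Complex.exp (-((ψ ξ - Ψ k ξ : ℝ) : ℂ)) := fun k => by
    refine exists_charFun_eq_of_tendsto
      (μ := fun m => ⟨compoundPoisson (ν.restrict (A (m + k) \ A k)), inferInstance⟩) ?_ ?_
    · have h0 : Tendsto (fun ξ => ψ ξ - Ψ k ξ) (𝓝 0) (𝓝 0) := by
        refine tendsto_of_tendsto_of_tendsto_of_le_of_le tendsto_const_nhds (hψ0 ▸ hψ.tendsto 0)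
          (fun ξ => sub_nonneg.2 (hΨ_le k ξ)) fun ξ => ?_
        simpa using hΨ_nonneg k ξ
      have h1 : ψ 0 - Ψ k 0 = 0 := by simp [hΨ, hψ0]
      unfold ContinuousAt
      simp only [h1]
      exact (Complex.continuous_exp.tendsto _).comp
        ((Complex.continuous_ofReal.tendsto _).comp h0).neg
    · intro ξ
      simp only [ProbabilityMeasure.coe_mk]
      simp_rw [fun m => hcp' k (m + k) (Nat.le_add_left k m) ξ]
      exact (Complex.continuous_exp.tendsto _).comp ((Complex.continuous_ofReal.tendsto _).comp
        (((tendsto_add_atTop_iff_nat k).2 (hΨ_lim ξ)).sub_const _)).neg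
  choose ρ hρ using hres
  refine ⟨A, ρ, hf, fun k => ?_, ?_⟩
  · apply Measure.ext_of_charFun
    ext ξ
    rw [charFun_conv, hμ, hρ, hcp, ← Complex.exp_add]
    congr 1
    push_cast
    ring
  · refine ProbabilityMeasure.tendsto_of_tendsto_charFun fun ξ => ?_
    simp_rw [hρ]
    have h0 : Tendsto (fun k => ψ ξ - Ψ k ξ) atTop (𝓝 0) := by
      simpa using (hΨ_lim ξ).const_sub (ψ ξ)
    have := (Complex.continuous_exp.tendsto _).comp
        ((Complex.continuous_ofReal.tendsto _).comp h0).neg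
    simpa [Function.comp_def] using this

/-- Averaging a bounded function against one factor of a convolution leaves a vanishing variance
with respect to the other factor when the latter tends to the point mass at `0`. -/
lemma exists_variance_integral_add_le {d : ℕ} {μ : Measure (EuclideanSpace ℝ (Fin d))}
    [IsProbabilityMeasure μ] {ρ : ℕ → ProbabilityMeasure (EuclideanSpace ℝ (Fin d))}
    {σ : ℕ → Measure (EuclideanSpace ℝ (Fin d))} [∀ k, IsProbabilityMeasure (σ k)]
    (hμ : ∀ k, μ = (ρ k : Measure _) ∗ σ k)
    (hρ : Tendsto ρ atTop (𝓝 ⟨Measure.dirac 0, inferInstance⟩))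
    {f : EuclideanSpace ℝ (Fin d) → ℝ} (hf : Measurable f) {M : ℝ} (hM : ∀ x, |f x| ≤ M)
    {η : ℝ} (hη : 0 < η) :
    ∃ k, ENNReal.ofReal (variance (fun x => ∫ y, f (x + y) ∂(σ k)) (ρ k : Measure _)) ≤
      ENNReal.ofReal η := by
  obtain ⟨g, hgs, hfg, hgc, -⟩ := MemLp.exists_hasCompactSupport_integral_rpow_sub_le
    (μ := μ) (p := 2) two_pos (f := f) (by simpa using memLp_of_abs_le hf hM 2)
    (ε := η / 8) (by positivity)
  obtain ⟨K, hK⟩ := hgs.exists_bound_of_continuous hgc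
  have hK' : ∀ x, |g x| ≤ K := hK
  obtain ⟨δ, hδ, hu⟩ := Metric.uniformContinuous_iff.1 (hgs.uniformContinuous_of_continuous hgc)
    (Real.sqrt (η / 8)) (by positivity)
  have hgm := hgc.measurable
  let b : BoundedContinuousFunction (EuclideanSpace ℝ (Fin d)) ℝ :=
    BoundedContinuousFunction.ofNormedAddCommGroup (fun x => min 1 (‖x‖ / δ)) (by fun_prop) 1
      fun x => by
        rw [Real.norm_of_nonneg (by positivity)]
        exact min_le_left _ _
  have hb0 : ∀ x, 0 ≤ b x := fun x => by
    change 0 ≤ min 1 (‖x‖ / δ)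
    positivity
  have hb : ∀ x y, (g (x + y) - g y) ^ 2 ≤ η / 8 + 4 * K ^ 2 * b x := fun x y => by
    change _ ≤ η / 8 + 4 * K ^ 2 * min 1 (‖x‖ / δ)
    rcases lt_or_ge ‖x‖ δ with h | h
    · have h1 := hu (a := x + y) (b := y) (by simpa [dist_eq_norm] using h)
      rw [Real.dist_eq] at h1
      have h2 : (g (x + y) - g y) ^ 2 ≤ η / 8 := by
        rw [← sq_abs, ← Real.sq_sqrt (show 0 ≤ η / 8 by positivity)]
        gcongr
      have : 0 ≤ 4 * K ^ 2 * min 1 (‖x‖ / δ) := by positivity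
      linarith
    · rw [min_eq_left ((one_le_div hδ).2 h)]
      have h1 := abs_le.1 (hK' (x + y))
      have h2 := abs_le.1 (hK' y)
      nlinarith
  have hlim : Tendsto (fun k => ∫ x, b x ∂(ρ k : Measure _)) atTop (𝓝 0) := by
    have := ProbabilityMeasure.tendsto_iff_forall_integral_tendsto.1 hρ b
    simpa [b] using this
  have hlim' : Tendsto (fun k => 8 * K ^ 2 * ∫ x, b x ∂(ρ k : Measure _)) atTop (𝓝 0) := by
    simpa using hlim.const_mul (8 * K ^ 2)
  obtain ⟨k, hk⟩ := (hlim'.eventually (gt_mem_nhds (show 0 < η / 2 by positivity))).exists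
  refine ⟨k, ?_⟩
  have hMK : ∀ x, |f x - g x| ≤ M + K := fun x => (abs_sub _ _).trans (add_le_add (hM x) (hK' x))
  have hpt : ∀ x, ENNReal.ofReal (((∫ y, f (x + y) ∂(σ k)) - ∫ y, g y ∂(σ k)) ^ 2) ≤
      2 * ∫⁻ y, ENNReal.ofReal ((f (x + y) - g (x + y)) ^ 2) ∂(σ k) +
        ENNReal.ofReal (2 * (η / 8 + 4 * K ^ 2 * b x)) := fun x => by
    have e1 := ofReal_sq_integral_le (μ := σ k) (f := fun y => f (x + y) - g (x + y))
      (by fun_prop) fun y => hMK (x + y)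
    have e2 := ofReal_sq_integral_le (μ := σ k) (f := fun y => g (x + y) - g y)
      (by fun_prop) (M := 2 * K) fun y => (abs_sub _ _).trans
        (by linarith [hK' (x + y), hK' y])
    have e3 : ∫⁻ y, ENNReal.ofReal ((g (x + y) - g y) ^ 2) ∂(σ k) ≤
        ENNReal.ofReal (η / 8 + 4 * K ^ 2 * b x) := by
      refine (lintegral_mono fun y => ENNReal.ofReal_le_ofReal (hb x y)).trans_eq ?_
      simp
    have if1 : Integrable (fun y => f (x + y)) (σ k) :=
      integrable_of_abs_le (by fun_prop) fun y => hM _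
    have ig1 : Integrable (fun y => g (x + y)) (σ k) :=
      integrable_of_abs_le (by fun_prop) fun y => hK' _
    have ig2 : Integrable g (σ k) := integrable_of_abs_le hgm hK'
    rw [integral_sub if1 ig1] at e1
    rw [integral_sub ig1 ig2] at e2
    set a := ∫ y, f (x + y) ∂(σ k)
    set a' := ∫ y, g (x + y) ∂(σ k)
    set c := ∫ y, g y ∂(σ k)
    calc ENNReal.ofReal ((a - c) ^ 2)
        ≤ ENNReal.ofReal (2 * (a - a') ^ 2 + 2 * (a' - c) ^ 2) := by
          apply ENNReal.ofReal_le_ofReal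
          nlinarith [sq_nonneg (a - a' - (a' - c))]
      _ = 2 * ENNReal.ofReal ((a - a') ^ 2) + 2 * ENNReal.ofReal ((a' - c) ^ 2) := by
          rw [ENNReal.ofReal_add (by positivity) (by positivity),
            ENNReal.ofReal_mul zero_le_two, ENNReal.ofReal_mul zero_le_two, ENNReal.ofReal_ofNat]
      _ ≤ _ := by
          rw [ENNReal.ofReal_mul zero_le_two, ENNReal.ofReal_ofNat]
          exact add_le_add (mul_le_mul_right e1 2) (mul_le_mul_right (e2.trans e3) 2)
  have hfg' : ∫⁻ x, ENNReal.ofReal ((f x - g x) ^ 2) ∂μ ≤ ENNReal.ofReal (η / 8) := by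
    rw [← ofReal_integral_eq_lintegral_ofReal (f := fun x => (f x - g x) ^ 2)
      (memLp_of_abs_le (hf.sub hgm) hMK 2).integrable_sq (ae_of_all _ fun x => sq_nonneg _)]
    apply ENNReal.ofReal_le_ofReal
    simpa using hfg
  refine (ofReal_variance_le_lintegral_sq (measurable_integral_add hf)
    (fun x => abs_integral_le_of_abs_le fun y => hM (x + y)) (∫ y, g y ∂(σ k))).trans ?_
  refine (lintegral_mono hpt).trans ?_
  have hbint : Integrable (fun x => 2 * (η / 8 + 4 * K ^ 2 * b x)) (ρ k : Measure _) :=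
    ((integrable_const _).add ((b.integrable _).const_mul _)).const_mul _
  have hmeas : Measurable fun x => 2 * (η / 8 + 4 * K ^ 2 * b x) := by
    have := b.continuous
    fun_prop
  rw [lintegral_add_right _ hmeas.ennreal_ofReal, lintegral_const_mul' _ _ (by simp),
    ← Measure.lintegral_conv (f := fun x => ENNReal.ofReal ((f x - g x) ^ 2)) (by fun_prop), ← hμ k,
    ← ofReal_integral_eq_lintegral_ofReal hbint (ae_of_all _ fun x => by
      have := hb0 x
      positivity)]
  have hval : ∫ x, 2 * (η / 8 + 4 * K ^ 2 * b x) ∂(ρ k : Measure _) =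
      η / 4 + 8 * K ^ 2 * ∫ x, b x ∂(ρ k : Measure _) := by
    rw [integral_const_mul, integral_add (integrable_const _) ((b.integrable _).const_mul _),
      integral_const_mul]
    simp
    ring
  rw [hval]
  calc _ ≤ 2 * ENNReal.ofReal (η / 8) + ENNReal.ofReal (η / 4 + η / 2) := by gcongr
    _ = ENNReal.ofReal η := by
      rw [← ENNReal.ofReal_ofNat, ← ENNReal.ofReal_mul zero_le_two,
        ← ENNReal.ofReal_add (by positivity) (by positivity)]
      congr 1
      ring

/-- The Poincaré inequality on bounded functions for a law with symmetric Lévy measure. -/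
lemma ofReal_variance_le_Dform {d : ℕ} {μ ν : Measure (EuclideanSpace ℝ (Fin d))}
    [IsProbabilityMeasure μ] [SigmaFinite ν] [ν.IsNegInvariant]
    {ψ : EuclideanSpace ℝ (Fin d) → ℝ} (hψ : Continuous ψ) (hψ0 : ψ 0 = 0)
    (hψ_nonneg : ∀ ξ, 0 ≤ ψ ξ)
    (hν : ∀ ξ, ∫⁻ u, ENNReal.ofReal (1 - Real.cos ⟪ξ, u⟫) ∂ν = ENNReal.ofReal (ψ ξ))
    (hμ : ∀ ξ, charFun μ ξ = Complex.exp (-(ψ ξ : ℂ)))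
    {f : EuclideanSpace ℝ (Fin d) → ℝ} (hf : Measurable f) {M : ℝ} (hM : ∀ x, |f x| ≤ M) :
    ENNReal.ofReal (variance f μ) ≤ Dform ν μ f := by
  obtain ⟨A, ρ, hfin, hconv, hρ⟩ := exists_conv_compoundPoisson hψ hψ0 hψ_nonneg hν hμ
  refine ENNReal.le_of_forall_pos_le_add fun η hη _ => ?_
  obtain ⟨k, hk⟩ := exists_variance_integral_add_le hconv hρ hf hM (NNReal.coe_pos.2 hη)
  have h1 : ∫⁻ x, ENNReal.ofReal (variance (fun y => f (x + y))
      (compoundPoisson (ν.restrict (A k)))) ∂(ρ k : Measure _) ≤ Dform ν μ f := by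
    calc _ ≤ ∫⁻ x, Dform (ν.restrict (A k)) (compoundPoisson (ν.restrict (A k)))
          (fun y => f (x + y)) ∂(ρ k : Measure _) := lintegral_mono fun x => by
            simpa using hasPoincare_compoundPoisson (ν.restrict (A k)) (fun y => f (x + y))
              (by fun_prop) M fun y => hM _
      _ = Dform (ν.restrict (A k)) μ f := by rw [← Dform_conv hf, ← hconv k]
      _ ≤ Dform ν μ f := lintegral_mono fun x => lintegral_mono' Measure.restrict_le_self le_rfl
  have h2 := ofReal_variance_conv (μ₁ := (ρ k : Measure _))
    (μ₂ := compoundPoisson (ν.restrict (A k))) hf hM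
  rw [← hconv k] at h2
  rw [h2]
  refine add_le_add h1 (hk.trans_eq ?_)
  simp

/-- A Poincaré inequality on bounded functions extends to functions of finite variance. -/
lemma evariance_le_Dform_of_bounded {d : ℕ} {μ ν : Measure (EuclideanSpace ℝ (Fin d))}
    [IsProbabilityMeasure μ]
    (h : ∀ f : EuclideanSpace ℝ (Fin d) → ℝ, Measurable f → ∀ M : ℝ, (∀ x, |f x| ≤ M) →
      ENNReal.ofReal (variance f μ) ≤ Dform ν μ f)
    {f : EuclideanSpace ℝ (Fin d) → ℝ} (hf : Measurable f) (hfv : evariance f μ < ∞) :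
    evariance f μ ≤ Dform ν μ f := by
  have h2 := (evariance_lt_top_iff_memLp hf.aestronglyMeasurable).1 hfv
  let F : ℕ → EuclideanSpace ℝ (Fin d) → ℝ := fun n x => max (-(n : ℝ)) (min n (f x))
  have hFm : ∀ n, Measurable (F n) := fun n => by fun_prop
  have hFb : ∀ n x, |F n x| ≤ n := fun n x => by
    have hn : (0 : ℝ) ≤ n := n.cast_nonneg
    exact abs_le.2 ⟨le_max_left _ _, max_le (by linarith) (min_le_left _ _)⟩
  have hFf : ∀ n x, |F n x| ≤ |f x| := fun n x => by
    have hn : (0 : ℝ) ≤ n := n.cast_nonneg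
    refine abs_le.2 ⟨le_max_of_le_right (le_min ?_ (neg_abs_le (f x))), max_le ?_ ?_⟩
    · linarith [abs_nonneg (f x)]
    · linarith [abs_nonneg (f x)]
    · exact (min_le_right _ _).trans (le_abs_self (f x))
  have hFl : ∀ x, Tendsto (fun n => F n x) atTop (𝓝 (f x)) := fun x => by
    refine tendsto_const_nhds.congr' ?_
    filter_upwards [eventually_ge_atTop ⌈|f x|⌉₊] with n hn
    have h3 := abs_le.1 (Nat.ceil_le.1 hn)
    change f x = max (-(n : ℝ)) (min n (f x))
    rw [min_eq_right h3.2, max_eq_right h3.1]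
  have hFd : ∀ n, Dform ν μ (F n) ≤ Dform ν μ f := fun n => by
    refine lintegral_mono fun x => lintegral_mono fun u => ENNReal.ofReal_le_ofReal ?_
    refine sq_le_sq.2 ?_
    refine (abs_max_sub_max_le_max (-(n : ℝ)) (min n (f (x + u))) (-(n : ℝ))
      (min n (f x))).trans ?_
    refine max_le (by simp) ((abs_min_sub_min_le_max (n : ℝ) (f (x + u)) n (f x)).trans ?_)
    exact max_le (by simp) le_rfl
  have hlim : Tendsto (fun n => variance (F n) μ) atTop (𝓝 (variance f μ)) := by
    rw [variance_eq_sub h2]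
    simp_rw [fun n => variance_eq_sub (memLp_of_abs_le (μ := μ) (hFm n) (hFb n) 2)]
    refine Tendsto.sub ?_ (Tendsto.pow ?_ 2)
    · refine tendsto_integral_of_dominated_convergence (fun x => f x ^ 2)
        (fun n => ((hFm n).pow_const 2).aestronglyMeasurable) h2.integrable_sq
        (fun n => ae_of_all _ fun x => ?_) (ae_of_all _ fun x => (hFl x).pow 2)
      simp only [Pi.pow_apply, norm_pow, Real.norm_eq_abs]
      rw [← sq_abs (f x)]
      have := hFf n x
      gcongr
    · exact tendsto_integral_of_dominated_convergence (fun x => |f x|)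
        (fun n => (hFm n).aestronglyMeasurable) (h2.integrable one_le_two).abs
        (fun n => ae_of_all _ fun x => hFf n x) (ae_of_all _ hFl)
  rw [← ofReal_variance h2]
  exact le_of_tendsto' (ENNReal.tendsto_ofReal hlim) fun n =>
    (h _ (hFm n) n (hFb n)).trans (hFd n)

instance sigmaFinite_stableLevy (d : ℕ) (α : ℝ) : SigmaFinite (stableLevy d α) := by
  unfold stableLevy
  infer_instance

instance isNegInvariant_stableLevy (d : ℕ) (α : ℝ) : (stableLevy d α).IsNegInvariant := by
  constructor
  ext s hs
  change (stableLevy d α).map Neg.neg s = _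
  rw [Measure.map_apply measurable_neg hs, stableLevy, withDensity_apply _ (measurable_neg hs),
    withDensity_apply _ hs, ← lintegral_indicator (measurable_neg hs), ← lintegral_indicator hs,
    ← lintegral_neg_eq_self]
  congr with u
  have h : -u ∈ Neg.neg ⁻¹' s ↔ u ∈ s := by rw [mem_preimage, neg_neg]
  by_cases hu : u ∈ s
  · rw [indicator_of_mem (h.2 hu), indicator_of_mem hu, norm_neg]
  · rw [indicator_of_notMem (mt h.1 hu), indicator_of_notMem hu]

lemma charFun_eq_charFn {d : ℕ} (μ : Measure (EuclideanSpace ℝ (Fin d)))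
    (ξ : EuclideanSpace ℝ (Fin d)) : charFun μ ξ = charFn μ ξ := by
  rw [charFun_apply, charFn]
  congr with x
  rw [real_inner_comm, mul_comm]

/-- The Poincaré inequality for the rotationally invariant `α`-stable law. -/
lemma evariance_le_Dform_stableLevy {d : ℕ} (hd : 0 < d) {α : ℝ} (hα : α ∈ Ioo (1 : ℝ) 2)
    {μ : Measure (EuclideanSpace ℝ (Fin d))} [IsProbabilityMeasure μ]
    (hchar : ∀ ξ, charFn μ ξ = Complex.exp (-((‖ξ‖ ^ α / 2 : ℝ) : ℂ)))
    {f : EuclideanSpace ℝ (Fin d) → ℝ} (hf : Measurable f) (hfv : evariance f μ < ∞) :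
    evariance f μ ≤ Dform (stableLevy d α) μ f := by
  have hα0 : 0 < α := zero_lt_one.trans hα.1
  refine evariance_le_Dform_of_bounded (fun g hg M hM => ?_) hf hfv
  refine ofReal_variance_le_Dform (ψ := fun ξ => ‖ξ‖ ^ α / 2) ?_ ?_ (fun ξ => by positivity)
    (lintegral_one_sub_cos_stableLevy hd hα) (fun ξ => by rw [charFun_eq_charFn, hchar]) hg hM
  · exact (continuous_norm.rpow_const fun _ => Or.inr hα0.le).div_const 2
  · simp [Real.zero_rpow hα0.ne']

lemma two_mul_ofReal (a : ℝ) : 2 * ENNReal.ofReal a = ENNReal.ofReal (2 * a) := by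
  rw [ENNReal.ofReal_mul zero_le_two, ENNReal.ofReal_ofNat]

lemma Dform_cos_add_Dform_sin {d : ℕ} {μ ν : Measure (EuclideanSpace ℝ (Fin d))}
    [IsProbabilityMeasure μ] [SFinite ν] (ξ : EuclideanSpace ℝ (Fin d)) :
    Dform ν μ (fun x => Real.cos ⟪ξ, x⟫) + Dform ν μ (fun x => Real.sin ⟪ξ, x⟫) =
      2 * ∫⁻ u, ENNReal.ofReal (1 - Real.cos ⟪ξ, u⟫) ∂ν := by
  have hc : Measurable fun x : EuclideanSpace ℝ (Fin d) => Real.cos ⟪ξ, x⟫ := by fun_prop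
  unfold Dform
  rw [← lintegral_add_left (measurable_lintegral_sq_sub hc)]
  have key : ∀ x, ∫⁻ u, ENNReal.ofReal ((Real.cos ⟪ξ, x + u⟫ - Real.cos ⟪ξ, x⟫) ^ 2) ∂ν +
      ∫⁻ u, ENNReal.ofReal ((Real.sin ⟪ξ, x + u⟫ - Real.sin ⟪ξ, x⟫) ^ 2) ∂ν =
      2 * ∫⁻ u, ENNReal.ofReal (1 - Real.cos ⟪ξ, u⟫) ∂ν := fun x => by
    rw [← lintegral_add_left (by fun_prop), ← lintegral_const_mul' _ _ (by simp)]
    refine lintegral_congr fun u => ?_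
    rw [← ENNReal.ofReal_add (sq_nonneg _) (sq_nonneg _), two_mul_ofReal]
    congr 1
    rw [inner_add_right, Real.cos_add, Real.sin_add]
    have h1 := Real.sin_sq_add_cos_sq ⟪ξ, x⟫
    have h2 := Real.sin_sq_add_cos_sq ⟪ξ, u⟫
    linear_combination (Real.cos ⟪ξ, u⟫ ^ 2 + Real.sin ⟪ξ, u⟫ ^ 2 + 1 - 2 * Real.cos ⟪ξ, u⟫) * h1 +
      h2
  simp_rw [key]
  simp

lemma variance_cos_add_variance_sin {d : ℕ} {μ : Measure (EuclideanSpace ℝ (Fin d))}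
    [IsProbabilityMeasure μ] (ξ : EuclideanSpace ℝ (Fin d)) :
    variance (fun x => Real.cos ⟪ξ, x⟫) μ + variance (fun x => Real.sin ⟪ξ, x⟫) μ =
      1 - Complex.normSq (charFn μ ξ) := by
  have hcm : Measurable fun x : EuclideanSpace ℝ (Fin d) => Real.cos ⟪ξ, x⟫ := by fun_prop
  have hsm : Measurable fun x : EuclideanSpace ℝ (Fin d) => Real.sin ⟪ξ, x⟫ := by fun_prop
  have hc2 := memLp_of_abs_le (μ := μ) hcm (fun x => Real.abs_cos_le_one _) 2
  have hs2 := memLp_of_abs_le (μ := μ) hsm (fun x => Real.abs_sin_le_one _) 2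
  have h1 : ∫ x, Real.cos ⟪ξ, x⟫ ^ 2 ∂μ + ∫ x, Real.sin ⟪ξ, x⟫ ^ 2 ∂μ = 1 := by
    rw [← integral_add hc2.integrable_sq hs2.integrable_sq]
    simp
  have h2 : charFn μ ξ = (∫ x, Real.cos ⟪ξ, x⟫ ∂μ : ℝ) + (∫ x, Real.sin ⟪ξ, x⟫ ∂μ : ℝ) *
      Complex.I := by
    rw [charFn, ← integral_complex_ofReal, ← integral_complex_ofReal, ← integral_mul_const,
      ← integral_add (hc2.integrable one_le_two).ofReal
        ((hs2.integrable one_le_two).ofReal.mul_const _)]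
    congr with x
    rw [mul_comm, Complex.exp_mul_I]
    simp
  rw [variance_eq_sub hc2, variance_eq_sub hs2, h2, Complex.normSq_add_mul_I]
  simp only [Pi.pow_apply]
  linarith

/-- Rigidity: the Poincaré-ratio functional of the rotationally invariant `α`-stable
law equals `1` (`cor:rigidity1`). -/
theorem stmt12 (d : ℕ) (hd : 0 < d) (α : ℝ) (hα : α ∈ Ioo (1 : ℝ) 2)
    (μα : Measure (EuclideanSpace ℝ (Fin d))) [IsProbabilityMeasure μα]
    (hchar : ∀ ξ, charFn μα ξ = Complex.exp (-((‖ξ‖ ^ α / 2 : ℝ) : ℂ))) :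
    Ufun (stableLevy d α) μα = 1 := by
  have hle : ∀ f : EuclideanSpace ℝ (Fin d) → ℝ, Measurable f → evariance f μα < ⊤ →
      evariance f μα ≤ Dform (stableLevy d α) μα f := fun f hf hfv =>
    evariance_le_Dform_stableLevy hd hα hchar hf hfv
  have hub : ∀ v ∈ {v : ℝ | ∃ f : EuclideanSpace ℝ (Fin d) → ℝ, Measurable f ∧
      evariance f μα < ⊤ ∧ 0 < Dform (stableLevy d α) μα f ∧ Dform (stableLevy d α) μα f < ⊤ ∧
      v = (evariance f μα).toReal / (Dform (stableLevy d α) μα f).toReal}, v ≤ 1 := by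
    rintro v ⟨f, hf, hfv, -, hD, rfl⟩
    exact div_le_one_of_le₀ (ENNReal.toReal_mono hD.ne (hle f hf hfv)) ENNReal.toReal_nonneg
  refine le_antisymm (Real.sSup_le hub zero_le_one) ?_
  set s := Ufun (stableLevy d α) μα with hs
  have hratio : ∀ f : EuclideanSpace ℝ (Fin d) → ℝ, Measurable f → (∀ x, |f x| ≤ 1) →
      Dform (stableLevy d α) μα f < ⊤ →
      variance f μα ≤ s * (Dform (stableLevy d α) μα f).toReal := fun f hf hf1 hD => by
    have hfv : evariance f μα < ⊤ := evariance_lt_top (memLp_of_abs_le hf hf1 2)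
    change (evariance f μα).toReal ≤ _
    rcases eq_or_ne (Dform (stableLevy d α) μα f) 0 with h0 | h0
    · have := hle f hf hfv
      rw [h0, nonpos_iff_eq_zero] at this
      simp [h0, this]
    · rw [← div_le_iff₀ (ENNReal.toReal_pos h0 hD.ne)]
      exact le_csSup ⟨1, hub⟩ ⟨f, hf, hfv, pos_iff_ne_zero.2 h0, hD, rfl⟩
  have hα0 : 0 < α := zero_lt_one.trans hα.1
  have key : ∀ t : ℝ, 0 < t → 1 ≤ s * (1 + t) := fun t ht => by
    let ξ : EuclideanSpace ℝ (Fin d) := EuclideanSpace.single ⟨0, hd⟩ (t ^ α⁻¹)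
    have hξ : ‖ξ‖ ^ α = t := by
      rw [PiLp.norm_single, Real.norm_of_nonneg (by positivity),
        Real.rpow_inv_rpow ht.le hα0.ne']
    have hD := Dform_cos_add_Dform_sin (μ := μα) (ν := stableLevy d α) ξ
    rw [lintegral_one_sub_cos_stableLevy hd hα, hξ, two_mul_ofReal,
      mul_div_cancel₀ _ two_ne_zero] at hD
    have hV := variance_cos_add_variance_sin (μ := μα) ξ
    rw [hchar, hξ, ← Complex.ofReal_neg, ← Complex.ofReal_exp, Complex.normSq_ofReal,
      ← Real.exp_add, ← neg_add, add_halves] at hV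
    have hDc : Dform (stableLevy d α) μα (fun x => Real.cos ⟪ξ, x⟫) < ⊤ :=
      (le_self_add.trans_eq hD).trans_lt ENNReal.ofReal_lt_top
    have hDs : Dform (stableLevy d α) μα (fun x => Real.sin ⟪ξ, x⟫) < ⊤ :=
      (le_add_self.trans_eq hD).trans_lt ENNReal.ofReal_lt_top
    have h1 := hratio _ (by fun_prop) (fun x => Real.abs_cos_le_one _) hDc
    have h2 := hratio _ (by fun_prop) (fun x => Real.abs_sin_le_one _) hDs
    have h3 := congrArg ENNReal.toReal hD
    rw [ENNReal.toReal_add hDc.ne hDs.ne, ENNReal.toReal_ofReal ht.le] at h3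
    have h4 : 1 - Real.exp (-t) ≤ s * t := by
      rw [← hV, ← h3, mul_add]
      exact add_le_add h1 h2
    have h5 : Real.exp (-t) * (1 + t) ≤ 1 := by
      rw [Real.exp_neg, inv_mul_le_one₀ (Real.exp_pos t)]
      linarith [Real.add_one_le_exp t]
    have h6 : t ≤ s * t * (1 + t) := by nlinarith
    nlinarith
  by_contra! hlt
  have h1 := key 1 one_pos
  have h2 := key ((1 - s) / 2) (by linarith)
  nlinarith
end
end

section
/- Let α ∈ (1,2) and let μ_α be the rotationally invariant α-stable probability measure on ℝ^d with characteristic function φ(ξ) = exp(−‖ξ‖^α/2). For s ≥ 0 let μ_s^{OU} be the probability measure with characteristic function φ(ξ)/φ(e^{−s}ξ) = exp(−(1 − e^{−αs})‖ξ‖^α/2) (i.e., the law of (1 − e^{−αs})^{1/α} X_α with X_α ∼ μ_α), and define P_s^{ν_α}(f)(x) = ∫ f(x e^{−s} + y) μ_s^{OU}(dy). Then for every Schwartz function f ∈ S(ℝ^d), every s ≥ 0 and every j ∈ {1,…,d}, ∫_{ℝ^d} x_j P_s^{ν_α}(f)(x) μ_α(dx) = e^{−(α−1)s} ∫_{ℝ^d}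 x_j f(x) μ_α(dx); in other words, the coordinate functions g_j(x) = x_j are eigenfunctions with eigenvalue e^{−(α−1)s} of the L²(μ_α)-adjoint of the stable Ornstein–Uhlenbeck-type semigroup (P_s^{ν_α}). -/
open MeasureTheory ProbabilityTheory Filter Set
open scoped RealInnerProductSpace ENNReal NNReal Topology

noncomputable section

open scoped FourierTransform

/-- A lower bound for `∫ (1 - cos (t u)) / t ^ 2 dt` over `t > 0`, linear in `|u|`. -/
lemma mul_abs_le_lintegral_one_sub_cos (u : ℝ) :
    ENNReal.ofReal (2 / Real.pi ^ 2 * |u|)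
      ≤ ∫⁻ t in Ioi (0 : ℝ), ENNReal.ofReal ((1 - Real.cos (t * u)) / t ^ 2) := by
  rcases eq_or_ne u 0 with rfl | hu
  · simp
  have hu' : 0 < |u| := abs_pos.mpr hu
  calc ENNReal.ofReal (2 / Real.pi ^ 2 * |u|)
      = ∫⁻ _ in Ioc (0 : ℝ) (1 / |u|), ENNReal.ofReal (2 / Real.pi ^ 2 * u ^ 2) := by
        rw [setLIntegral_const, Real.volume_Ioc, ← ENNReal.ofReal_mul (by positivity)]
        congr 1
        rw [← sq_abs u]
        field_simp
        ring
    _ ≤ ∫⁻ t in Ioc (0 : ℝ) (1 / |u|), ENNReal.ofReal ((1 - Real.cos (t * u)) / t ^ 2) := by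
        refine setLIntegral_mono' measurableSet_Ioc fun t ht ↦ ENNReal.ofReal_le_ofReal ?_
        have ht0 : 0 < t := ht.1
        have h1 : |t * u| ≤ Real.pi := by
          rw [abs_mul, abs_of_pos ht0]
          have := (le_div_iff₀ hu').mp ht.2
          linarith [Real.pi_gt_three]
        rw [le_div_iff₀ (by positivity)]
        have := Real.cos_le_one_sub_mul_cos_sq h1
        nlinarith
    _ ≤ _ := lintegral_mono_set Ioc_subset_Ioi_self

/-- A real random variable whose characteristic function satisfies `1 - Re φ(t) ≤ t ^ α` for `t > 0`
and some `α > 1` is integrable. -/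
lemma integrable_of_integral_one_sub_cos_le {Ω : Type*} [MeasurableSpace Ω] {P : Measure Ω}
    [IsProbabilityMeasure P] {u : Ω → ℝ} (hu : Measurable u) {α : ℝ} (hα : 1 < α)
    (h : ∀ t : ℝ, 0 < t → ∫ ω, (1 - Real.cos (t * u ω)) ∂P ≤ t ^ α) :
    Integrable u P := by
  have hint (t : ℝ) : Integrable (fun ω ↦ 1 - Real.cos (t * u ω)) P := by
    refine Integrable.of_bound (C := 2) (by fun_prop) (.of_forall fun ω ↦ ?_)
    rw [Real.norm_eq_abs, abs_le]
    constructor <;> linarith [Real.cos_le_one (t * u ω), Real.neg_one_le_cos (t * u ω)]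
  have hmean (t : ℝ) (ht : 0 < t) : ∫⁻ ω, ENNReal.ofReal ((1 - Real.cos (t * u ω)) / t ^ 2) ∂P
      = ENNReal.ofReal ((∫ ω, (1 - Real.cos (t * u ω)) ∂P) / t ^ 2) := by
    rw [← integral_div, ofReal_integral_eq_lintegral_ofReal ((hint t).div_const _)]
    exact .of_forall fun ω ↦ div_nonneg (by linarith [Real.cos_le_one (t * u ω)]) (sq_nonneg t)
  have hfin : ∫⁻ ω, ENNReal.ofReal (2 / Real.pi ^ 2 * |u ω|) ∂P < ⊤ := by
    calc ∫⁻ ω, ENNReal.ofReal (2 / Real.pi ^ 2 * |u ω|) ∂P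
        ≤ ∫⁻ ω, (∫⁻ t in Ioi (0 : ℝ), ENNReal.ofReal ((1 - Real.cos (t * u ω)) / t ^ 2)) ∂P :=
          lintegral_mono fun ω ↦ mul_abs_le_lintegral_one_sub_cos (u ω)
      _ = ∫⁻ t in Ioi (0 : ℝ), ∫⁻ ω, ENNReal.ofReal ((1 - Real.cos (t * u ω)) / t ^ 2) ∂P :=
          lintegral_lintegral_swap
            (f := fun ω t ↦ ENNReal.ofReal ((1 - Real.cos (t * u ω)) / t ^ 2))
            (Measurable.aemeasurable (by unfold Function.uncurry; fun_prop))
      _ ≤ (∫⁻ t in Ioc (0 : ℝ) 1, ∫⁻ ω, ENNReal.ofReal ((1 - Real.cos (t * u ω)) / t ^ 2) ∂P)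
          + ∫⁻ t in Ioi (1 : ℝ), ∫⁻ ω, ENNReal.ofReal ((1 - Real.cos (t * u ω)) / t ^ 2) ∂P := by
          rw [← Ioc_union_Ioi_eq_Ioi zero_le_one]
          exact lintegral_union_le _ _ _
      _ ≤ (∫⁻ t in Ioc (0 : ℝ) 1, ENNReal.ofReal (t ^ (α - 2)))
          + ∫⁻ t in Ioi (1 : ℝ), ENNReal.ofReal (2 * t ^ (-2 : ℝ)) := by
          gcongr ?_ + ?_
          · refine setLIntegral_mono' measurableSet_Ioc fun t ht ↦ ?_
            rw [hmean t ht.1]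
            refine ENNReal.ofReal_le_ofReal ?_
            rw [Real.rpow_sub ht.1, Real.rpow_two]
            have := h t ht.1
            gcongr
          · refine setLIntegral_mono' measurableSet_Ioi fun t ht ↦ ?_
            have ht0 : (0 : ℝ) < t := zero_lt_one.trans ht
            rw [hmean t ht0, Real.rpow_neg ht0.le, Real.rpow_two, ← div_eq_mul_inv]
            refine ENNReal.ofReal_le_ofReal ?_
            gcongr
            calc ∫ ω, (1 - Real.cos (t * u ω)) ∂P ≤ ∫ _, (2 : ℝ) ∂P :=
                  integral_mono (hint t) (integrable_const _) fun ω ↦ by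
                    show 1 - Real.cos (t * u ω) ≤ 2
                    linarith [Real.neg_one_le_cos (t * u ω)]
              _ = 2 := by simp
      _ < ⊤ := by
          refine ENNReal.add_lt_top.mpr ⟨?_, ?_⟩
          · have h1 := (intervalIntegral.intervalIntegrable_rpow' (a := 0) (b := 1)
              (show -1 < α - 2 by linarith)).1
            exact h1.lintegral_lt_top
          · exact ((integrableOn_Ioi_rpow_of_lt (by norm_num) one_pos).const_mul 2).lintegral_lt_top
  have hc : Integrable (fun ω ↦ 2 / Real.pi ^ 2 * |u ω|) P := by
    refine ⟨by fun_prop, ?_⟩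
    rwa [hasFiniteIntegral_iff_ofReal (.of_forall fun ω ↦ by positivity)]
  have habs : Integrable (fun ω ↦ |u ω|) P := by
    refine (hc.const_mul (Real.pi ^ 2 / 2)).congr (.of_forall fun ω ↦ ?_)
    have := Real.pi_pos
    simp only
    field_simp
  exact (integrable_norm_iff hu.aestronglyMeasurable).mp habs

/-- Fourier representation of the integral of a Schwartz function along a measurable map. -/
lemma integral_mul_schwartz_eq {V Ω : Type*} [NormedAddCommGroup V] [InnerProductSpace ℝ V]
    [FiniteDimensional ℝ V] [MeasurableSpace V] [BorelSpace V] [MeasurableSpace Ω] {P : Measure Ω}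
    [SFinite P] {h : Ω → ℂ} (hh : Integrable h P) {T : Ω → V} (hT : Measurable T)
    (f : SchwartzMap V ℂ) :
    ∫ ω, h ω * f (T ω) ∂P = ∫ ξ, 𝓕 f ξ *
      ∫ ω, h ω * Complex.exp (Complex.I * (⟪(2 * Real.pi) • ξ, T ω⟫ : ℂ)) ∂P := by
  have hf (x : V) : f x
      = ∫ ξ, 𝓕 f ξ * Complex.exp (Complex.I * (⟪(2 * Real.pi) • ξ, x⟫ : ℂ)) := by
    conv_lhs =>
      rw [← FourierTransform.fourierInv_fourier_eq (E := SchwartzMap V ℂ) (F := SchwartzMap V ℂ) f]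
    rw [SchwartzMap.fourierInv_coe, Real.fourierInv_eq']
    refine integral_congr_ae (.of_forall fun ξ ↦ ?_)
    simp only [smul_eq_mul, inner_smul_left]
    rw [mul_comm]
    congr 2
    push_cast
    simp
    ring
  calc ∫ ω, h ω * f (T ω) ∂P
      = ∫ ω, (∫ ξ, h ω *
          (𝓕 f ξ * Complex.exp (Complex.I * (⟪(2 * Real.pi) • ξ, T ω⟫ : ℂ)))) ∂P := by
        simp_rw [integral_const_mul, ← hf]
    _ = ∫ ξ, ∫ ω, h ω * (𝓕 f ξ * Complex.exp (Complex.I * (⟪(2 * Real.pi) • ξ, T ω⟫ : ℂ))) ∂P := by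
        refine integral_integral_swap ?_
        have h1 : Integrable (fun p : Ω × V ↦ h p.1 * 𝓕 f p.2) (P.prod volume) :=
          hh.mul_prod (𝓕 f).integrable
        refine (h1.mul_bdd (c := 1)
          (g := fun p ↦ Complex.exp (Complex.I * (⟪(2 * Real.pi) • p.2, T p.1⟫ : ℂ))) ?_ ?_).congr ?_
        · fun_prop
        · refine .of_forall fun p ↦ ?_
          rw [mul_comm, Complex.norm_exp_ofReal_mul_I]
        · exact .of_forall fun p ↦ by simp [Function.uncurry, mul_assoc]
    _ = _ := by
        simp_rw [← integral_const_mul]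
        congr 1 with ξ
        congr 1 with ω
        ring

section Stable

variable {d : ℕ} {α : ℝ} {μ : Measure (EuclideanSpace ℝ (Fin d))} [IsProbabilityMeasure μ]

lemma integrable_exp_I_inner (ξ : EuclideanSpace ℝ (Fin d)) :
    Integrable (fun x ↦ Complex.exp (Complex.I * (⟪ξ, x⟫ : ℂ))) μ := by
  refine Integrable.of_bound (C := 1) (by fun_prop) (.of_forall fun x ↦ ?_)
  rw [mul_comm, Complex.norm_exp_ofReal_mul_I]

lemma integrable_coord (hα : 1 < α)
    (hchar : ∀ ξ, charFn μ ξ = Complex.exp (-((‖ξ‖ ^ α / 2 : ℝ) : ℂ))) (j : Fin d) :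
    Integrable (fun x ↦ x j) μ := by
  refine integrable_of_integral_one_sub_cos_le (by fun_prop) hα fun t ht ↦ ?_
  have hcos : ∫ x : EuclideanSpace ℝ (Fin d), Real.cos (t * x j) ∂μ = Real.exp (-(t ^ α / 2)) := by
    have h := congrArg Complex.re (hchar (t • EuclideanSpace.single j 1))
    rw [charFn, ← RCLike.re_eq_complex_re, ← integral_re (integrable_exp_I_inner _)] at h
    rw [← Complex.ofReal_neg, ← Complex.ofReal_exp] at h
    simpa [inner_smul_left, EuclideanSpace.inner_single_left, norm_smul, abs_of_pos ht,
      Complex.exp_re] using h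
  have hint : Integrable (fun x : EuclideanSpace ℝ (Fin d) ↦ Real.cos (t * x j)) μ :=
    Integrable.of_bound (C := 1) (by fun_prop) (.of_forall fun x ↦ Real.abs_cos_le_one _)
  rw [integral_sub (integrable_const _) hint, hcos]
  simp only [integral_const, probReal_univ, smul_eq_mul, mul_one]
  linarith [Real.add_one_le_exp (-(t ^ α / 2)), Real.rpow_pos_of_pos ht α]

/-- The Fourier transform of the vector measure `x_j μ_α(dx)`. -/
lemma integral_coord_mul_exp (hα : 1 < α)
    (hchar : ∀ ξ, charFn μ ξ = Complex.exp (-((‖ξ‖ ^ α / 2 : ℝ) : ℂ)))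
    (j : Fin d) (ξ : EuclideanSpace ℝ (Fin d)) :
    ∫ x, (x j : ℂ) * Complex.exp (Complex.I * (⟪ξ, x⟫ : ℂ)) ∂μ
      = Complex.I * ((α / 2 * ‖ξ‖ ^ (α - 2) * ξ j : ℝ) : ℂ)
        * Complex.exp (-((‖ξ‖ ^ α / 2 : ℝ) : ℂ)) := by
  set e : EuclideanSpace ℝ (Fin d) := EuclideanSpace.single j 1 with he
  have hinner (x : EuclideanSpace ℝ (Fin d)) : ⟪e, x⟫ = x j := by
    simp [he, EuclideanSpace.inner_single_left]
  have hline (t : ℝ) : HasDerivAt (fun t : ℝ ↦ ξ + t • e) e t := by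
    simpa using ((hasDerivAt_id t).smul_const e).const_add ξ
  have hleft : HasDerivAt (fun t : ℝ ↦ charFn μ (ξ + t • e))
      (∫ x, Complex.exp (Complex.I * (⟪ξ + (0 : ℝ) • e, x⟫ : ℂ)) * (Complex.I * (x j : ℂ)) ∂μ) 0 := by
    have hbound : ∀ᵐ x ∂μ, ∀ t ∈ (univ : Set ℝ),
        ‖Complex.exp (Complex.I * (⟪ξ + t • e, x⟫ : ℂ)) * (Complex.I * (x j : ℂ))‖ ≤ |x j| := by
      refine .of_forall fun x t _ ↦ ?_
      rw [norm_mul, mul_comm Complex.I, Complex.norm_exp_ofReal_mul_I]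
      simp
    have hdiff : ∀ᵐ x ∂μ, ∀ t ∈ (univ : Set ℝ),
        HasDerivAt (fun t : ℝ ↦ Complex.exp (Complex.I * (⟪ξ + t • e, x⟫ : ℂ)))
          (Complex.exp (Complex.I * (⟪ξ + t • e, x⟫ : ℂ)) * (Complex.I * (x j : ℂ))) t := by
      refine .of_forall fun x t _ ↦ ?_
      have h1 : HasDerivAt (fun t : ℝ ↦ ⟪ξ + t • e, x⟫) (x j) t := by
        simpa [hinner] using (hline t).inner ℝ (hasDerivAt_const t x)
      exact (h1.ofReal_comp.const_mul Complex.I).cexp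
    exact (hasDerivAt_integral_of_dominated_loc_of_deriv_le (x₀ := (0 : ℝ)) univ_mem
      (.of_forall fun t ↦ (integrable_exp_I_inner _).aestronglyMeasurable)
      (integrable_exp_I_inner _) (by fun_prop) hbound (integrable_coord hα hchar j).abs hdiff).2
  have hright : HasDerivAt (fun t : ℝ ↦ charFn μ (ξ + t • e))
      (Complex.exp (-((‖ξ‖ ^ α / 2 : ℝ) : ℂ))
        * -((α * ‖ξ‖ ^ (α - 2) * ξ j / 2 : ℝ) : ℂ)) 0 := by
    have h1 : HasDerivAt (fun t : ℝ ↦ ‖ξ + t • e‖ ^ α) (α * ‖ξ‖ ^ (α - 2) * ξ j) 0 := by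
      have h2 := (hasFDerivAt_norm_rpow (ξ + (0 : ℝ) • e) hα).comp_hasDerivAt 0 (hline 0)
      simpa [Function.comp_def, real_inner_comm e ξ, hinner] using h2
    simp_rw [hchar]
    simpa using ((h1.div_const 2).ofReal_comp.neg).cexp
  have h := hleft.unique hright
  rw [zero_smul, add_zero] at h
  have hI : Complex.I * ∫ x, (x j : ℂ) * Complex.exp (Complex.I * (⟪ξ, x⟫ : ℂ)) ∂μ
      = Complex.exp (-((‖ξ‖ ^ α / 2 : ℝ) : ℂ)) * -((α * ‖ξ‖ ^ (α - 2) * ξ j / 2 : ℝ) : ℂ) := by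
    rw [← h, ← integral_const_mul]
    congr 1 with x
    ring
  refine mul_left_cancel₀ Complex.I_ne_zero (hI.trans ?_)
  push_cast
  linear_combination (-(α / 2 * (‖ξ‖ ^ (α - 2) : ℝ) * ξ j
    * Complex.exp (-((‖ξ‖ ^ α : ℝ) / 2 : ℂ))) : ℂ) * Complex.I_mul_I

end Stable

/-- The coordinate functions are eigenfunctions, with eigenvalue `e^{−(α−1)s}`, of the
`L²(μ_α)`-adjoint of the stable Ornstein–Uhlenbeck-type semigroup (`lem:link`). -/
theorem stmt15 (d : ℕ) (hd : 0 < d) (α : ℝ) (hα : α ∈ Ioo (1 : ℝ) 2)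
    (μα : Measure (EuclideanSpace ℝ (Fin d))) [IsProbabilityMeasure μα]
    (hchar : ∀ ξ, charFn μα ξ = Complex.exp (-((‖ξ‖ ^ α / 2 : ℝ) : ℂ)))
    (μOU : ℝ → Measure (EuclideanSpace ℝ (Fin d)))
    (hOUprob : ∀ s : ℝ, 0 ≤ s → IsProbabilityMeasure (μOU s))
    (hOUchar : ∀ s : ℝ, 0 ≤ s → ∀ ξ, charFn (μOU s) ξ
      = Complex.exp (-(((1 - Real.exp (-α * s)) * ‖ξ‖ ^ α / 2 : ℝ) : ℂ))) :
    ∀ (f : SchwartzMap (EuclideanSpace ℝ (Fin d)) ℝ) (s : ℝ), 0 ≤ s → ∀ j : Fin d,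
      ∫ x, x j * (∫ y, f (Real.exp (-s) • x + y) ∂(μOU s)) ∂μα
        = Real.exp (-(α - 1) * s) * ∫ x, x j * f x ∂μα := by
  intro f s hs j
  have := hOUprob s hs
  set g : SchwartzMap (EuclideanSpace ℝ (Fin d)) ℂ :=
    f.postcompCLM Complex.ofRealCLM with hg
  have hgf (x : EuclideanSpace ℝ (Fin d)) : g x = f x := rfl
  have hcoord : Integrable (fun x : EuclideanSpace ℝ (Fin d) ↦ (x j : ℂ)) μα :=
    (integrable_coord hα.1 hchar j).ofReal
  have hcoord' : Integrable (fun p : EuclideanSpace ℝ (Fin d) × EuclideanSpace ℝ (Fin d) ↦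
      (p.1 j : ℂ)) (μα.prod (μOU s)) := hcoord.comp_fst _
  have hprod : ∫ x, (x j : ℂ) * (∫ y, g (Real.exp (-s) • x + y) ∂(μOU s)) ∂μα
      = ∫ p, (p.1 j : ℂ) * g (Real.exp (-s) • p.1 + p.2) ∂(μα.prod (μOU s)) := by
    obtain ⟨C, hC⟩ : ∃ C, ∀ x, ‖g x‖ ≤ C := by
      obtain ⟨C, -, hC⟩ := g.decay 0 0
      exact ⟨C, fun x ↦ by simpa using hC x⟩
    have hint : Integrable (fun p : EuclideanSpace ℝ (Fin d) × EuclideanSpace ℝ (Fin d) ↦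
        (p.1 j : ℂ) * g (Real.exp (-s) • p.1 + p.2)) (μα.prod (μOU s)) := by
      refine hcoord'.mul_bdd (c := C) (Continuous.aestronglyMeasurable ?_)
        (.of_forall fun p ↦ hC _)
      exact g.continuous.comp (by fun_prop)
    rw [integral_prod _ hint]
    simp_rw [integral_const_mul]
  have hfactor (η : EuclideanSpace ℝ (Fin d)) :
      ∫ p, (p.1 j : ℂ) * Complex.exp (Complex.I * (⟪η, Real.exp (-s) • p.1 + p.2⟫ : ℂ))
          ∂(μα.prod (μOU s))
        = (Real.exp (-(α - 1) * s) : ℂ) *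
          ∫ x, (x j : ℂ) * Complex.exp (Complex.I * (⟪η, x⟫ : ℂ)) ∂μα := by
    calc _ = (∫ x, (x j : ℂ) * Complex.exp (Complex.I * (⟪Real.exp (-s) • η, x⟫ : ℂ)) ∂μα)
            * charFn (μOU s) η := by
          rw [charFn, ← integral_prod_mul]
          congr 1 with p
          rw [mul_assoc, ← Complex.exp_add, inner_add_right, inner_smul_left, inner_smul_right]
          simp [mul_add]
      _ = _ := by
          have hr : 0 < Real.exp (-s) := Real.exp_pos _
          have hexp (b : ℝ) : Real.exp (-s) ^ b = Real.exp (-s * b) := (Real.exp_mul _ _).symm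
          rw [integral_coord_mul_exp hα.1 hchar, integral_coord_mul_exp hα.1 hchar, hOUchar s hs,
            norm_smul, Real.norm_of_nonneg hr.le, Real.mul_rpow hr.le (norm_nonneg _),
            Real.mul_rpow hr.le (norm_nonneg _), hexp, hexp, mul_assoc, ← Complex.exp_add]
          have h1 : Real.exp (-s * (α - 2)) * Real.exp (-s) = Real.exp (-(α - 1) * s) := by
            rw [← Real.exp_add]
            ring_nf
          have h2 : -s * α = -α * s := by ring
          have h3 : -((Real.exp (-s * α) * ‖η‖ ^ α / 2 : ℝ) : ℂ)
              + -(((1 - Real.exp (-α * s)) * ‖η‖ ^ α / 2 : ℝ) : ℂ) = -((‖η‖ ^ α / 2 : ℝ) : ℂ) := by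
            rw [h2]
            push_cast
            ring
          rw [h3, ← h1, PiLp.smul_apply, smul_eq_mul]
          push_cast
          ring
  apply Complex.ofReal_injective
  rw [Complex.ofReal_mul]
  simp_rw [← integral_complex_ofReal, Complex.ofReal_mul, ← integral_complex_ofReal, ← hgf]
  have hT : Measurable (fun p : EuclideanSpace ℝ (Fin d) × EuclideanSpace ℝ (Fin d) ↦
      Real.exp (-s) • p.1 + p.2) := by fun_prop
  have hid := integral_mul_schwartz_eq hcoord measurable_id g
  simp only [id] at hid
  rw [hprod, integral_mul_schwartz_eq hcoord' hT, hid, ← integral_const_mul]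
  congr 1 with ξ
  rw [hfactor]
  ring
end
end
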